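/- arXiv:1411.3695 — 4 statements merged into one kernel-verified Lean document; each statement's English description precedes it below -/
import Mathlib

section
/- Let d ≥ 1. Then β_{i,i+d-1}(K[sd(Δ_{d-1})]) ≠ 0 if and only if i = 2^d - d - 1. -/
open Finset BigOperators

noncomputable section
open scoped Classical

/-- A finite abstract simplicial complex on (a finite subset of) `ℕ`,
given as its finite set of faces. -/
abbrev SC := Finset (Finset ℕ)

/-- `Δ` is a simplicial complex: it is closed under taking subsets of faces. -/
def IsComplex {α : Type*} [DecidableEq α] (Δ : Finset (Finset α)) : Prop :=
  ∀ s ∈ Δ, ∀ t ⊆ s, t ∈ Δ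

/-- The vertex set (ground set) of a complex: the union of all of its faces. -/
def vertexSet {α : Type*} [DecidableEq α] (Δ : Finset (Finset α)) : Finset α :=
  Δ.sup id

/-- The number of vertices of a complex. -/
def nverts {α : Type*} [DecidableEq α] (Δ : Finset (Finset α)) : ℕ :=
  (vertexSet Δ).card

/-- The full `(d-1)`-simplex `Δ_{d-1}`: all subsets of a `d`-element vertex set. -/
def simplexC (d : ℕ) : SC := (Finset.range d).powerset

/-- The boundary complex of the simplex on `k` vertices (a `(k-2)`-sphere):
all proper subsets of a `k`-element vertex set. -/
def boundaryC (k : ℕ) : SC := ((Finset.range k).powerset).erase (Finset.range k)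

/-- Encoding of finite subsets of `ℕ` as natural numbers (injective). -/
def enc : Finset ℕ → ℕ := Encodable.encode

/-- `C` is a chain of sets under inclusion. -/
def IsChainF (C : Finset (Finset ℕ)) : Prop := ∀ s ∈ C, ∀ t ∈ C, s ⊆ t ∨ t ⊆ s

/-- The barycentric subdivision `sd(Δ)`: its vertices are (encodings of) the
nonempty faces of `Δ`, and its faces are the chains of nonempty faces of `Δ`. -/
def sd (Δ : SC) : SC :=
  ((Δ.erase ∅).powerset.filter IsChainF).image (fun C => C.image enc)

/-- The induced subcomplex `Δ_W` on a vertex subset `W`. -/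
def inducedSC {α : Type*} [DecidableEq α] (Δ : Finset (Finset α)) (W : Finset α) :
    Finset (Finset α) := Δ.filter (fun s => s ⊆ W)

/-- `fvec Δ k` is the number of faces of `Δ` of cardinality `k`
(i.e. of dimension `k-1`); so `f_{i}^Δ = fvec Δ (i+1)`. -/
def fvec (Δ : SC) (k : ℕ) : ℕ := (Δ.filter (fun s => s.card = k)).card

/-- A minimal non-face of a complex. -/
def IsMinNonFace {α : Type*} [DecidableEq α] (Δ : Finset (Finset α)) (N : Finset α) : Prop :=
  N ⊆ vertexSet Δ ∧ N ∉ Δ ∧ ∀ M ⊂ N, M ∈ Δ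

/-- `t_1(K[Δ])`: the largest cardinality of a minimal non-face of `Δ`, equivalently the
largest degree of a minimal generator of the Stanley-Reisner ideal `I_Δ`. -/
def t1 {α : Type*} [DecidableEq α] (Δ : Finset (Finset α)) : ℕ :=
  ((vertexSet Δ).powerset.filter (fun N => IsMinNonFace Δ N)).sup Finset.card

/-- A complex is flag if all its minimal non-faces have cardinality `2`. -/
def IsFlag {α : Type*} [DecidableEq α] (Δ : Finset (Finset α)) : Prop :=
  ∀ N : Finset α, IsMinNonFace Δ N → N.card = 2

/-- A complex is a full simplex if it consists of all subsets of its vertex set. -/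
def IsFullSimplex {α : Type*} [DecidableEq α] (Δ : Finset (Finset α)) : Prop :=
  Δ = (vertexSet Δ).powerset

/-- Abstract isomorphism of simplicial complexes (possibly on different ground sets):
there is a map of vertices, injective on the vertex set, carrying the faces of the first
complex exactly onto the faces of the second. -/
def ComplexIso {α β : Type*} [DecidableEq α] [DecidableEq β]
    (Δ : Finset (Finset α)) (Γ : Finset (Finset β)) : Prop :=
  ∃ φ : α → β, Set.InjOn φ ↑(vertexSet Δ) ∧ Γ = Δ.image (fun s => s.image φ)

variable (K : Type*) [Field K]

/-- The boundary of (the indicator chain of) a single face, with the usual signs coming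
from the ordering of the vertices. -/
def bdryFace (s : Finset ℕ) : Finset ℕ →₀ K :=
  ∑ v ∈ s, ((-1 : K) ^ ((s.filter (fun w => w < v)).card)) • Finsupp.single (s.erase v) (1 : K)

/-- The simplicial boundary operator on the (augmented/reduced) chain space. -/
def bdry : (Finset ℕ →₀ K) →ₗ[K] (Finset ℕ →₀ K) :=
  Finsupp.lsum K fun s => LinearMap.toSpanSingleton K (Finset ℕ →₀ K) (bdryFace K s)

/-- The span of the faces of `Δ` of cardinality `n` (empty for `n < 0`):
the space of `(n-1)`-dimensional reduced chains of `Δ`. -/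
def facesSpan (Δ : SC) (n : ℤ) : Submodule K (Finset ℕ →₀ K) :=
  Submodule.span K ((fun s => Finsupp.single s (1 : K)) '' {s | s ∈ Δ ∧ (s.card : ℤ) = n})

/-- Reduced `(n-1)`-cycles of `Δ`. -/
def cyclesOn (Δ : SC) (n : ℤ) : Submodule K (Finset ℕ →₀ K) :=
  facesSpan K Δ n ⊓ LinearMap.ker (bdry K)

/-- Reduced `(n-1)`-boundaries of `Δ`. -/
def boundariesOn (Δ : SC) (n : ℤ) : Submodule K (Finset ℕ →₀ K) :=
  Submodule.map (bdry K) (facesSpan K Δ (n + 1))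

/-- `redHdim K Δ n = dim_K H̃_{n-1}(Δ; K)`, the dimension of reduced simplicial homology
of `Δ` in the degree whose chains are the faces of cardinality `n`. -/
def redHdim (Δ : SC) (n : ℤ) : ℕ :=
  Module.finrank K ↥(cyclesOn K Δ n) -
    Module.finrank K ↥(boundariesOn K Δ n ⊓ cyclesOn K Δ n)

/-- The graded Betti number `β_{i,j}(K[Δ]) = dim_K Tor_i^S(K[Δ], K)_j` of the
Stanley-Reisner ring of `Δ`, expressed (via Hochster's formula) through reduced homology of
induced subcomplexes: `β_{i,j} = Σ_{W ⊆ Ω, #W = j} dim_K H̃_{j-i-1}(Δ_W; K)`. -/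
def bettiSR (Δ : SC) (i j : ℕ) : ℕ :=
  ∑ W ∈ (vertexSet Δ).powerset.filter (fun W => W.card = j),
    redHdim K (inducedSC Δ W) ((j : ℤ) - i)

/-- The projective dimension of `K[Δ]` over the polynomial ring: the largest homological
degree with a nonzero Betti number. -/
def pdimSR (Δ : SC) : ℕ :=
  ((Finset.range (nverts Δ + 1)).filter
    (fun i => ∃ j ∈ Finset.range (2 * nverts Δ + 1), bettiSR K Δ i j ≠ 0)).sup id

/-- The depth of `K[Δ]` (via the Auslander–Buchsbaum formula). -/
def depthSR (Δ : SC) : ℕ := nverts Δ - pdimSR K Δ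

/-- The Castelnuovo–Mumford regularity of `K[Δ]`:
the largest `j - i` with `β_{i,j}(K[Δ]) ≠ 0`. -/
def regSR (Δ : SC) : ℕ :=
  ((Finset.range (nverts Δ + 1) ×ˢ Finset.range (2 * nverts Δ + 1))).sup
    (fun p => if bettiSR K Δ p.1 p.2 ≠ 0 then p.2 - p.1 else 0)

/-- The number of homological degrees `i` with `β_{i,i+j}(K[Δ]) ≠ 0`. -/
def strandCount (Δ : SC) (j : ℕ) : ℕ :=
  ((Finset.range (nverts Δ + 1)).filter (fun i => bettiSR K Δ i (i + j) ≠ 0)).card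

/-- The numbers `m_j(d)`: `m_j(d) = j` if `j ≤ d/2`, and
`m_j(d) = 2^{a+2}(c+d-j) - 2d + j` if `j ≥ d/2`, where `2j-d = a(d-j)+c`, `0 ≤ c < d-j`. -/
def mj (d j : ℕ) : ℕ :=
  if 2 * j ≤ d then j
  else 2 ^ ((2 * j - d) / (d - j) + 2) * ((2 * j - d) % (d - j) + (d - j)) + j - 2 * d

/-- `N(d)`: the number of vertices of `sd^3(Δ_{d-1})` not lying on the boundary
of `sd^3(Δ_{d-1})`. -/
def Nd (d : ℕ) : ℕ :=
  ((vertexSet (sd^[3] (simplexC d))) \ (vertexSet (sd^[3] (boundaryC d)))).card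

/-- The induced subcomplex `σ̃` of `Δ` spanned by the support of a chain `σ`:
all faces of `Δ` contained in some face of the support of `σ`. -/
def cycleCplx (Δ : SC) (σ : Finset ℕ →₀ K) : SC :=
  Δ.filter (fun F => ∃ G ∈ σ.support, F ⊆ G)

/-- `σ` is a minimal homology `(d-1)`-cycle of the `(d-1)`-dimensional complex `Δ`:
a nonzero `(d-1)`-cycle such that no nonzero `(d-1)`-cycle `σ'` satisfies
`f_i^{σ̃} > f_i^{σ̃'}` and `f_j^{σ̃} = f_j^{σ̃'}` for all `i < j ≤ d-1`, for some `i`. -/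
def IsMinimalCycle (Δ : SC) (d : ℕ) (σ : Finset ℕ →₀ K) : Prop :=
  σ ≠ 0 ∧ σ ∈ cyclesOn K Δ (d : ℤ) ∧
    ∀ σ' : Finset ℕ →₀ K, σ' ≠ 0 → σ' ∈ cyclesOn K Δ (d : ℤ) →
      ¬ ∃ i ≤ d - 1, fvec (cycleCplx K Δ σ') (i + 1) < fvec (cycleCplx K Δ σ) (i + 1) ∧
          ∀ j, i < j → j ≤ d - 1 →
            fvec (cycleCplx K Δ σ) (j + 1) = fvec (cycleCplx K Δ σ') (j + 1)

/-- The support of a lattice point, as a set of natural numbers. -/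
def tupSupp {n : ℕ} (a : Fin n → ℕ) : Finset ℕ :=
  (Finset.univ.filter (fun l : Fin n => a l ≠ 0)).image Fin.val

/-- The `k`-th component of `𝔦(a) = Σ_l a_l u_l`, where `u_l = e_l + ⋯ + e_n`;
so `𝔦(a)_k = Σ_{l ≤ k} a_l`. -/
def iComp {n : ℕ} (a : Fin n → ℤ) (k : Fin n) : ℤ :=
  ∑ l ∈ Finset.univ.filter (fun l : Fin n => l ≤ k), a l

/-- The compatibility condition on pairs of vertices in the edgewise subdivision:
`𝔦(a-b) ∈ {0,1}^n` or `𝔦(b-a) ∈ {0,1}^n`. -/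
def edgeOK {n : ℕ} (a b : Fin n → ℕ) : Prop :=
  (∀ k, iComp (fun l => (a l : ℤ) - (b l : ℤ)) k ∈ ({0, 1} : Set ℤ)) ∨
  (∀ k, iComp (fun l => (b l : ℤ) - (a l : ℤ)) k ∈ ({0, 1} : Set ℤ))

/-- The `r`-th edgewise subdivision of a complex `Δ` on vertex set `[n]`, as a complex on
the ground set `Ω_{r,n}` of lattice points (tuples). -/
def edgewiseT (n r : ℕ) (Δ : SC) : Finset (Finset (Fin n → ℕ)) :=
  (Finset.Nat.antidiagonalTuple n r).powerset.filter
    (fun F => F.sup tupSupp ∈ Δ ∧ ∀ a ∈ F, ∀ b ∈ F, edgeOK a b)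

/-- Encoding of lattice points as natural numbers (injective). -/
def encTup {n : ℕ} (a : Fin n → ℕ) : ℕ := Encodable.encode (List.ofFn a)

/-- The `r`-th edgewise subdivision `Δ^{⟨r⟩}`, re-encoded as a complex on `ℕ`. -/
def edgewise (n r : ℕ) (Δ : SC) : SC :=
  (edgewiseT n r Δ).image (fun F => F.image encTup)

end


noncomputable section
open scoped Classical

theorem mem_facesSpan_iff (K : Type*) [Field K] (Δ : SC) (n : ℤ) (z : Finset ℕ →₀ K) :
    z ∈ facesSpan K Δ n ↔ ∀ s, z s ≠ 0 → s ∈ Δ ∧ (s.card : ℤ) = n := by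
  unfold facesSpan
  rw [← Finsupp.supported_eq_span_single, Finsupp.mem_supported]
  constructor
  · intro h s hs
    exact h (Finsupp.mem_support_iff.2 hs)
  · intro h s hs
    exact h s (Finsupp.mem_support_iff.1 hs)

theorem bdry_single (K : Type*) [Field K] (s : Finset ℕ) (c : K) :
    bdry K (Finsupp.single s c) = c • bdryFace K s := by
  simp [bdry]

def coneF (K : Type*) [Field K] (t : ℕ) (s : Finset ℕ) : Finset ℕ →₀ K :=
  if t ∈ s then 0 else
    ((-1 : K) ^ ((s.filter (fun w => w < t)).card)) • Finsupp.single (insert t s) (1 : K)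

def coneM (K : Type*) [Field K] (t : ℕ) : (Finset ℕ →₀ K) →ₗ[K] (Finset ℕ →₀ K) :=
  Finsupp.lsum K fun s => LinearMap.toSpanSingleton K (Finset ℕ →₀ K) (coneF K t s)

theorem coneM_single (K : Type*) [Field K] (t : ℕ) (s : Finset ℕ) (c : K) :
    coneM K t (Finsupp.single s c) = c • coneF K t s := by
  simp [coneM]

theorem cone_homotopy_face (K : Type*) [Field K] (t : ℕ) (s : Finset ℕ) :
    bdry K (coneF K t s) + coneM K t (bdryFace K s) = Finsupp.single s 1 := by
  by_cases ht : t ∈ s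
  · have : coneF K t s = 0 := by simp [coneF, ht]
    rw [this, map_zero, zero_add]
    unfold bdryFace
    rw [map_sum, Finset.sum_eq_single t]
    · rw [map_smul, coneM_single, one_smul]
      simp only [coneF, Finset.notMem_erase, if_false, Finset.insert_erase ht]
      have : (s.erase t).filter (fun w => w < t) = s.filter (fun w => w < t) := by
        ext w; simp only [mem_filter, mem_erase]; constructor
        · tauto
        · rintro ⟨h1, h2⟩; exact ⟨⟨by omega, h1⟩, h2⟩
      rw [this, smul_smul, ← pow_add, ← two_mul, pow_mul]
      simp
    · intro b hb hbt
      rw [map_smul, coneM_single]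
      have : t ∈ s.erase b := mem_erase.2 ⟨fun h => hbt h.symm, ht⟩
      simp [coneF, this]
    · intro h; exact absurd ht h
  · have h1 : coneF K t s = ((-1 : K) ^ ((s.filter (fun w => w < t)).card)) •
        Finsupp.single (insert t s) (1 : K) := by simp [coneF, ht]
    rw [h1, map_smul, bdry_single, one_smul]
    unfold bdryFace
    rw [Finset.sum_insert ht, map_sum, smul_add, Finset.erase_insert ht, smul_smul]
    have h2 : (insert t s).filter (fun w => w < t) = s.filter (fun w => w < t) := by
      rw [Finset.filter_insert, if_neg (lt_irrefl t)]
    rw [h2, ← pow_add, ← two_mul, pow_mul, neg_one_sq, one_pow, one_smul, add_assoc,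
      Finset.smul_sum, ← Finset.sum_add_distrib]
    convert add_zero _
    apply Finset.sum_eq_zero
    intro v hv
    have hvt : v ≠ t := fun h => ht (h ▸ hv)
    have h3 : (insert t s).erase v = insert t (s.erase v) := by
      rw [Finset.erase_insert_of_ne (Ne.symm hvt)]
    have h4 : t ∉ s.erase v := fun h => ht (mem_of_mem_erase h)
    rw [map_smul, coneM_single, one_smul, coneF, if_neg h4, h3, smul_smul, smul_smul, ← add_smul]
    convert zero_smul K _
    rw [Finset.filter_insert, ← pow_add, ← pow_add, Finset.filter_erase]
    rcases lt_or_gt_of_ne hvt with h | h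
    · rw [if_neg (by omega), Finset.card_erase_of_mem (by simp [hv, h])]
      have : 0 < (s.filter (fun w => w < t)).card := card_pos.2 ⟨v, by simp [hv, h]⟩
      obtain ⟨m, hm⟩ := Nat.exists_eq_succ_of_ne_zero this.ne'
      rw [hm, Nat.succ_sub_one, Nat.succ_eq_add_one]
      ring
    · rw [if_pos h, Finset.card_insert_of_notMem (by simp [ht]), Finset.erase_eq_of_notMem (by simp; omega)]
      ring

theorem cone_homotopy (K : Type*) [Field K] (t : ℕ) (z : Finset ℕ →₀ K) :
    bdry K (coneM K t z) + coneM K t (bdry K z) = z := by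
  induction z using Finsupp.induction_linear with
  | zero => simp
  | add f g hf hg =>
    simp only [map_add]
    conv_rhs => rw [← hf, ← hg]
    abel
  | single s c =>
    rw [coneM_single, bdry_single, map_smul, map_smul, ← smul_add, cone_homotopy_face]
    simp

theorem redHdim_cone (K : Type*) [Field K] (Δ : SC) (t : ℕ) (h : ∀ s ∈ Δ, insert t s ∈ Δ) (n : ℤ) :
    redHdim K Δ n = 0 := by
  have : cyclesOn K Δ n ≤ boundariesOn K Δ n := by
    rintro z ⟨hz, hz0⟩
    refine ⟨coneM K t z, ?_, ?_⟩
    · have hz' := (mem_facesSpan_iff K Δ n z).1 hz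
      have : coneM K t z = z.sum fun s c => c • coneF K t s := by
        simp only [coneM, Finsupp.lsum_apply]; rfl
      rw [this]
      apply Submodule.sum_mem
      intro s hs
      apply Submodule.smul_mem
      obtain ⟨h1, h2⟩ := hz' s (Finsupp.mem_support_iff.1 hs)
      unfold coneF
      split_ifs with hts
      · exact Submodule.zero_mem _
      · apply Submodule.smul_mem
        apply Submodule.subset_span
        refine ⟨_, ⟨h s h1, ?_⟩, rfl⟩
        rw [card_insert_of_notMem hts]; push_cast; omega
    · have := cone_homotopy K t z
      rw [LinearMap.mem_ker.1 hz0, map_zero, add_zero] at this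
      exact this
  unfold redHdim
  rw [inf_eq_right.2 this]
  simp

/-! encoding -/

def eF (n : ℕ) (A : Finset (Fin (n+1))) : ℕ := enc (A.image Fin.val)

theorem eF_inj (n : ℕ) : Function.Injective (eF n) := by
  intro A B h
  have := Encodable.encode_injective h
  exact Finset.image_injective Fin.val_injective this

theorem mem_sd_iff (n : ℕ) (s : Finset ℕ) : s ∈ sd (simplexC (n+1)) ↔
    ∃ C : Finset (Finset (Fin (n+1))), (∀ A ∈ C, A.Nonempty) ∧
      (∀ A ∈ C, ∀ B ∈ C, A ⊆ B ∨ B ⊆ A) ∧ s = C.image (eF n) := by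
  unfold sd simplexC
  simp only [mem_image, mem_filter, mem_powerset]
  constructor
  · rintro ⟨C, ⟨h1, h2⟩, rfl⟩
    have key : ∀ S ∈ C, ((univ : Finset (Fin (n+1))).filter (fun x => x.val ∈ S)).image Fin.val = S := by
      intro S hS
      have := (mem_erase.1 (h1 hS)).2
      rw [mem_powerset] at this
      ext x
      simp only [mem_image, mem_filter, mem_univ, true_and]
      constructor
      · rintro ⟨a, ha, rfl⟩; exact ha
      · intro hx; exact ⟨⟨x, mem_range.1 (this hx)⟩, hx, rfl⟩
    refine ⟨C.image (fun S => univ.filter (fun x => x.val ∈ S)), ?_, ?_, ?_⟩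
    · intro A hA
      obtain ⟨S, hS, rfl⟩ := mem_image.1 hA
      have h3 := (mem_erase.1 (h1 hS)).1
      rw [← Finset.nonempty_iff_ne_empty, ← key S hS, Finset.image_nonempty] at h3
      exact h3
    · intro A hA B hB
      obtain ⟨S, hS, rfl⟩ := mem_image.1 hA
      obtain ⟨T, hT, rfl⟩ := mem_image.1 hB
      rcases h2 S hS T hT with h | h
      · left; intro x; simp only [mem_filter, mem_univ, true_and]; exact fun hx => h hx
      · right; intro x; simp only [mem_filter, mem_univ, true_and]; exact fun hx => h hx
    · rw [Finset.image_image]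
      apply Finset.image_congr
      intro S hS
      simp only [Function.comp, eF, key S hS]
  · rintro ⟨C, h1, h2, rfl⟩
    refine ⟨C.image (fun A => A.image Fin.val), ⟨?_, ?_⟩, ?_⟩
    · intro S hS
      obtain ⟨A, hA, rfl⟩ := mem_image.1 hS
      rw [mem_erase, mem_powerset, ← Finset.nonempty_iff_ne_empty, Finset.image_nonempty]
      refine ⟨h1 A hA, ?_⟩
      intro x hx
      obtain ⟨a, _, rfl⟩ := mem_image.1 hx
      exact mem_range.2 a.2
    · intro S hS T hT
      obtain ⟨A, hA, rfl⟩ := mem_image.1 hS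
      obtain ⟨B, hB, rfl⟩ := mem_image.1 hT
      rcases h2 A hA B hB with h | h
      · left; exact Finset.image_subset_image h
      · right; exact Finset.image_subset_image h
    · rw [Finset.image_image]; rfl

theorem vertexSet_sd (n : ℕ) : vertexSet (sd (simplexC (n+1))) =
    ((univ : Finset (Finset (Fin (n+1)))).erase ∅).image (eF n) := by
  unfold vertexSet
  ext x
  simp only [Finset.mem_sup, id, mem_image, mem_erase, mem_univ, and_true]
  constructor
  · rintro ⟨s, hs, hx⟩
    obtain ⟨C, h1, h2, rfl⟩ := (mem_sd_iff n s).1 hs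
    obtain ⟨A, hA, rfl⟩ := mem_image.1 hx
    exact ⟨A, (h1 A hA).ne_empty, rfl⟩
  · rintro ⟨A, hA, rfl⟩
    refine ⟨{eF n A}, (mem_sd_iff n _).2 ⟨{A}, ?_, ?_, by simp⟩, by simp⟩
    · intro B hB; rw [mem_singleton.1 hB]; exact Finset.nonempty_iff_ne_empty.2 hA
    · intro B hB D hD; rw [mem_singleton.1 hB, mem_singleton.1 hD]; simp

theorem card_vertexSet_sd (n : ℕ) : (vertexSet (sd (simplexC (n+1)))).card = 2^(n+1) - 1 := by
  rw [vertexSet_sd, card_image_of_injective _ (eF_inj n), card_erase_of_mem (mem_univ _)]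
  simp

/-! flags -/

def Qf {n : ℕ} (p : Equiv.Perm (Fin (n+1))) (j : ℕ) : Finset (Fin (n+1)) :=
  univ.filter (fun x => (p.symm x).val ≤ j)

theorem mem_Qf {n : ℕ} (p : Equiv.Perm (Fin (n+1))) (j : ℕ) (x) :
    x ∈ Qf p j ↔ (p.symm x).val ≤ j := by simp [Qf]

theorem card_Qf {n : ℕ} (p : Equiv.Perm (Fin (n+1))) (j : ℕ) (hj : j < n + 1) :
    (Qf p j).card = j + 1 := by
  have : Qf p j = (Finset.Iic (⟨j, hj⟩ : Fin (n+1))).image p := by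
    ext x
    simp only [mem_Qf, mem_image, mem_Iic, Fin.le_def]
    constructor
    · intro h; exact ⟨p.symm x, h, by simp⟩
    · rintro ⟨a, h, rfl⟩; simpa using h
  rw [this, card_image_of_injective _ p.injective, Fin.card_Iic]

def FL {n : ℕ} (p : Equiv.Perm (Fin (n+1))) : Finset ℕ :=
  (range n).image (fun j => eF n (Qf p j))

theorem FLfun_injOn {n : ℕ} (p : Equiv.Perm (Fin (n+1))) :
    Set.InjOn (fun j => eF n (Qf p j)) (range n : Set ℕ) := by
  intro a ha b hb h
  have := congrArg Finset.card (eF_inj n h)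
  simp only [coe_range, Set.mem_Iio] at ha hb
  rw [card_Qf p a (by omega), card_Qf p b (by omega)] at this
  omega

theorem card_FL {n : ℕ} (p : Equiv.Perm (Fin (n+1))) : (FL p).card = n := by
  unfold FL
  rw [card_image_of_injOn (FLfun_injOn p), card_range]

theorem Qf_mono {n : ℕ} (p : Equiv.Perm (Fin (n+1))) {a b : ℕ} (h : a ≤ b) : Qf p a ⊆ Qf p b := by
  intro x; simp only [mem_Qf]; omega

theorem FL_mem_sd {n : ℕ} (p : Equiv.Perm (Fin (n+1))) : FL p ∈ sd (simplexC (n+1)) := by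
  refine (mem_sd_iff n _).2 ⟨(range n).image (Qf p), ?_, ?_, ?_⟩
  · intro A hA
    obtain ⟨j, hj, rfl⟩ := mem_image.1 hA
    exact ⟨p 0, by simp [mem_Qf]⟩
  · intro A hA B hB
    obtain ⟨j, hj, rfl⟩ := mem_image.1 hA
    obtain ⟨k, hk, rfl⟩ := mem_image.1 hB
    rcases le_total j k with h | h
    · left; exact Qf_mono p h
    · right; exact Qf_mono p h
  · rw [Finset.image_image]; rfl

theorem Qf_eq_of_mem {n : ℕ} (p q : Equiv.Perm (Fin (n+1))) {j : ℕ} (hj : j < n)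
    (h : eF n (Qf p j) ∈ FL q) : Qf p j = Qf q j := by
  obtain ⟨k, hk, h2⟩ := mem_image.1 h
  have h3 := eF_inj n h2
  have h4 := congrArg Finset.card h3
  have hk := mem_range.1 hk
  rw [card_Qf q k (by omega), card_Qf p j (by omega)] at h4
  obtain rfl : k = j := by omega
  exact h3.symm

theorem Qf_top {n : ℕ} (p : Equiv.Perm (Fin (n+1))) {j : ℕ} (hj : n ≤ j) : Qf p j = univ := by
  ext x; simp only [mem_Qf, mem_univ, iff_true]; have := (p.symm x).2; omega

theorem FL_injective {n : ℕ} : Function.Injective (FL (n := n)) := by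
  intro p q h
  have h1 : ∀ j, Qf p j = Qf q j := by
    intro j
    by_cases hj : j < n
    · apply Qf_eq_of_mem p q hj
      rw [← h]; exact mem_image_of_mem _ (mem_range.2 hj)
    · rw [Qf_top p (by omega), Qf_top q (by omega)]
  have h2 : p.symm = q.symm := by
    ext x
    have ha := (mem_Qf q (p.symm x) x).1 (h1 _ ▸ (mem_Qf p (p.symm x) x).2 le_rfl)
    have hb := (mem_Qf p (q.symm x) x).1 ((h1 _).symm ▸ (mem_Qf q (q.symm x) x).2 le_rfl)
    omega
  simpa using congrArg Equiv.symm h2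

theorem chain_inj {n : ℕ} (C : Finset (Finset (Fin (n+1))))
    (h2 : ∀ A ∈ C, ∀ B ∈ C, A ⊆ B ∨ B ⊆ A) : Set.InjOn Finset.card (C : Set (Finset (Fin (n+1)))) := by
  intro A hA B hB h
  rcases h2 A hA B hB with h' | h'
  · exact Finset.eq_of_subset_of_card_le h' h.ge
  · exact (Finset.eq_of_subset_of_card_le h' h.le).symm

theorem chain_card_image {n : ℕ} (C : Finset (Finset (Fin (n+1)))) (h1 : ∀ A ∈ C, A.Nonempty)
    (h3 : univ ∉ C) : C.image Finset.card ⊆ Finset.Icc 1 n := by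
  intro k hk
  obtain ⟨A, hA, rfl⟩ := mem_image.1 hk
  rw [mem_Icc]
  refine ⟨card_pos.2 (h1 A hA), ?_⟩
  have : A.card ≠ n + 1 := by
    intro h
    have : A = univ := by rw [← Finset.card_eq_iff_eq_univ]; simpa using h
    exact h3 (this ▸ hA)
  have h5 : A.card ≤ n + 1 := by simpa using Finset.card_le_univ A
  omega

theorem chain_card_le {n : ℕ} (C : Finset (Finset (Fin (n+1)))) (h1 : ∀ A ∈ C, A.Nonempty)
    (h2 : ∀ A ∈ C, ∀ B ∈ C, A ⊆ B ∨ B ⊆ A) (h3 : univ ∉ C) : C.card ≤ n := by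
  rw [← card_image_of_injOn (chain_inj C h2)]
  simpa using card_le_card (chain_card_image C h1 h3)

theorem chain_eq_flag {n : ℕ} (C : Finset (Finset (Fin (n+1)))) (h1 : ∀ A ∈ C, A.Nonempty)
    (h2 : ∀ A ∈ C, ∀ B ∈ C, A ⊆ B ∨ B ⊆ A) (h3 : univ ∉ C) (h4 : C.card = n) :
    ∃ p : Equiv.Perm (Fin (n+1)), C = (range n).image (Qf p) := by
  have hinj := chain_inj C h2
  have himg : C.image Finset.card = Finset.Icc 1 n := by
    apply Finset.eq_of_subset_of_card_le (chain_card_image C h1 h3)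
    rw [card_image_of_injOn hinj, h4]; simp
  let r : Fin (n+1) → Fin (n+1) := fun x =>
    ⟨(C.filter (fun A => x ∉ A)).card, by
      have := card_le_card (C.filter_subset (fun A => x ∉ A)); omega⟩
  have hr : ∀ A ∈ C, ∀ x, x ∈ A ↔ (r x).val < A.card := by
    intro A hA x
    constructor
    · intro hx
      have hs : ((C.filter (fun A => x ∉ A)).image Finset.card) ⊆ Finset.Ico 1 A.card := by
        intro k hk
        obtain ⟨B, hB, rfl⟩ := mem_image.1 hk
        obtain ⟨hB, hxB⟩ := mem_filter.1 hB
        rw [mem_Ico]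
        refine ⟨card_pos.2 (h1 B hB), ?_⟩
        apply card_lt_card
        rcases h2 A hA B hB with h | h
        · exact absurd (h hx) hxB
        · exact ⟨h, fun h' => hxB (h' hx)⟩
      have := card_le_card hs
      rw [card_image_of_injOn (hinj.mono (by intro B hB; exact (mem_filter.1 hB).1)),
        Nat.card_Ico] at this
      have h5 := card_pos.2 (h1 A hA)
      change (C.filter (fun A => x ∉ A)).card < _
      omega
    · intro hlt
      by_contra hx
      have hs : Finset.Icc 1 A.card ⊆ ((C.filter (fun A => x ∉ A)).image Finset.card) := by
        intro k hk
        have hA' : A.card ∈ Finset.Icc 1 n := himg ▸ mem_image_of_mem _ hA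
        rw [mem_Icc] at hk hA'
        have : k ∈ C.image Finset.card := by rw [himg, mem_Icc]; omega
        obtain ⟨B, hB, rfl⟩ := mem_image.1 this
        refine mem_image_of_mem _ (mem_filter.2 ⟨hB, fun hxB => ?_⟩)
        rcases h2 A hA B hB with h | h
        · have := Finset.eq_of_subset_of_card_le h hk.2
          exact hx (this ▸ hxB)
        · exact hx (h hxB)
      have := (card_le_card hs).trans card_image_le
      rw [Nat.card_Icc] at this
      change (C.filter (fun A => x ∉ A)).card < _ at hlt
      omega
  have hcount : ∀ k ≤ n + 1, (univ.filter (fun x => (r x).val < k)).card = k := by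
    intro k hk
    by_cases h0 : k = 0
    · subst h0; simp
    by_cases hn : k = n + 1
    · rw [Finset.filter_true_of_mem]
      · simp [hn]
      · intro x _; have := (r x).2; omega
    have : k ∈ C.image Finset.card := by rw [himg, mem_Icc]; omega
    obtain ⟨B, hB, rfl⟩ := mem_image.1 this
    congr 1
    ext x
    simp [hr B hB x]
  have hsurj : Function.Surjective r := by
    intro k
    by_contra hk
    push Not at hk
    have e1 := hcount k.val (by omega)
    have e2 := hcount (k.val + 1) (by omega)
    have : (univ.filter (fun x => (r x).val < k.val)) = (univ.filter (fun x => (r x).val < k.val + 1)) := by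
      ext x
      simp only [mem_filter, mem_univ, true_and]
      have := hk x
      rw [Ne, Fin.ext_iff] at this
      omega
    rw [this] at e1
    omega
  let q : Equiv.Perm (Fin (n+1)) := Equiv.ofBijective r (Finite.surjective_iff_bijective.1 hsurj)
  refine ⟨q.symm, Finset.eq_of_subset_of_card_le ?_ ?_⟩
  · intro A hA
    have h5 : A.card ∈ Finset.Icc 1 n := himg ▸ mem_image_of_mem _ hA
    rw [mem_Icc] at h5
    refine mem_image.2 ⟨A.card - 1, mem_range.2 (by omega), ?_⟩
    ext x
    rw [mem_Qf, hr A hA x]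
    change (r x).val ≤ _ ↔ _
    omega
  · rw [h4]; exact card_image_le.trans (by simp)

theorem face_eq_FL {n : ℕ} (W s : Finset ℕ) (hW : eF n univ ∉ W)
    (hs : s ∈ inducedSC (sd (simplexC (n+1))) W) (hc : s.card = n) :
    ∃ p : Equiv.Perm (Fin (n+1)), s = FL p := by
  obtain ⟨h1, h2⟩ := mem_filter.1 hs
  obtain ⟨C, c1, c2, rfl⟩ := (mem_sd_iff n s).1 h1
  rw [card_image_of_injective _ (eF_inj n)] at hc
  obtain ⟨p, rfl⟩ := chain_eq_flag C c1 c2 (fun h => hW (h2 (mem_image_of_mem _ h))) hc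
  exact ⟨p, by rw [Finset.image_image]; rfl⟩

def sw {n : ℕ} (i : Fin n) : Equiv.Perm (Fin (n+1)) := Equiv.swap i.castSucc i.succ

theorem sw_val {n : ℕ} (i : Fin n) (y : Fin (n+1)) :
    (sw i y).val = if y.val = i.val then i.val + 1 else if y.val = i.val + 1 then i.val else y.val := by
  unfold sw
  rw [Equiv.swap_apply_def]
  simp only [Fin.ext_iff, Fin.val_castSucc, Fin.val_succ]
  split_ifs <;> simp

theorem mem_Qf_sw {n : ℕ} (p : Equiv.Perm (Fin (n+1))) (i : Fin n) (j : ℕ) (x) :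
    x ∈ Qf (p * sw i) j ↔ (sw i (p.symm x)).val ≤ j := by
  rw [mem_Qf]
  rfl

theorem Qf_sw {n : ℕ} (p : Equiv.Perm (Fin (n+1))) (i : Fin n) (j : ℕ) (h : j ≠ i.val) :
    Qf (p * sw i) j = Qf p j := by
  ext x
  rw [mem_Qf_sw, mem_Qf, sw_val]
  split_ifs <;> omega

theorem ridge_flags {n : ℕ} (p q : Equiv.Perm (Fin (n+1))) (i : Fin n)
    (h : ∀ j < n, j ≠ i.val → Qf p j = Qf q j) : FL q = FL p ∨ FL q = FL (p * sw i) := by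
  have h' : ∀ j, j ≠ i.val → ∀ x, (p.symm x).val ≤ j ↔ (q.symm x).val ≤ j := by
    intro j hj x
    rw [← mem_Qf, ← mem_Qf]
    by_cases hn : j < n
    · rw [h j hn hj]
    · rw [Qf_top p (by omega), Qf_top q (by omega)]
  have hx0 : ∀ x, (q.symm x).val = i.val → (p.symm x).val = i.val ∨ (p.symm x).val = i.val + 1 := by
    intro x hx
    have a1 := h' (i.val + 1) (by omega) x
    by_cases h0 : i.val = 0
    · omega
    · have a2 := h' (i.val - 1) (by omega) x
      omega
  have hlt : ∀ x, (q.symm x).val < i.val ↔ (p.symm x).val < i.val := by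
    intro x
    by_cases h0 : i.val = 0
    · omega
    · have a2 := h' (i.val - 1) (by omega) x
      omega
  have huniq : ∀ (r : Equiv.Perm (Fin (n+1))) (x y), (r.symm x).val = (r.symm y).val → x = y := by
    intro r x y hxy
    exact r.symm.injective (Fin.ext hxy)
  obtain ⟨x0, hx0q⟩ : ∃ x, (q.symm x).val = i.val := ⟨q i.castSucc, by simp⟩
  have hq : ∀ x, (q.symm x).val = i.val ↔ x = x0 := by
    intro x
    constructor
    · intro hx; exact huniq q _ _ (hx.trans hx0q.symm)
    · rintro rfl; exact hx0q
  have fin : ∀ r : Equiv.Perm (Fin (n+1)), (∀ j < n, Qf q j = Qf r j) → FL q = FL r := by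
    intro r hr
    unfold FL
    apply Finset.image_congr
    intro j hj
    simp only [hr j (by simpa using hj)]
  rcases hx0 x0 hx0q with hp | hp
  · left
    apply fin
    intro j hj
    by_cases hji : j = i.val
    · subst hji
      ext x
      rw [mem_Qf, mem_Qf, Nat.le_iff_lt_or_eq, Nat.le_iff_lt_or_eq, hlt x, hq x]
      have : (p.symm x).val = i.val ↔ x = x0 := by
        constructor
        · intro hx; exact huniq p _ _ (hx.trans hp.symm)
        · rintro rfl; exact hp
      rw [this]
    · exact (h j hj hji).symm
  · right
    apply fin
    intro j hj
    by_cases hji : j = i.val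
    · subst hji
      ext x
      rw [mem_Qf, mem_Qf_sw, Nat.le_iff_lt_or_eq, hlt x, hq x, sw_val]
      have : (p.symm x).val = i.val + 1 ↔ x = x0 := by
        constructor
        · intro hx; exact huniq p _ _ (hx.trans hp.symm)
        · rintro rfl; exact hp
      rw [← this]
      split_ifs <;> omega
    · rw [Qf_sw p i j hji]; exact (h j hj hji).symm

theorem bdryFace_apply_erase (K : Type*) [Field K] (F : Finset ℕ) (v : ℕ) (hv : v ∈ F) :
    bdryFace K F (F.erase v) ≠ 0 := by
  unfold bdryFace
  rw [Finsupp.finsetSum_apply, Finset.sum_eq_single v]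
  · simp
  · intro b hb hbv
    have : F.erase b ≠ F.erase v := fun h => hbv (Finset.erase_injOn F hb hv h)
    simp [Finsupp.single_apply, this]
  · intro h; exact absurd hv h

theorem bdryFace_apply_ne (K : Type*) [Field K] (F R : Finset ℕ) (h : ¬ R ⊆ F) :
    bdryFace K F R = 0 := by
  unfold bdryFace
  rw [Finsupp.finsetSum_apply]
  apply Finset.sum_eq_zero
  intro b hb
  have : F.erase b ≠ R := fun h' => h (h' ▸ Finset.erase_subset _ _)
  simp [Finsupp.single_apply, this]

theorem bdry_apply (K : Type*) [Field K] (z : Finset ℕ →₀ K) (R : Finset ℕ) :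
    bdry K z R = ∑ F ∈ z.support, z F * bdryFace K F R := by
  have : bdry K z = z.sum fun s c => c • bdryFace K s := by
    simp only [bdry, Finsupp.lsum_apply]; rfl
  rw [this, Finsupp.sum, Finsupp.finsetSum_apply]
  rfl

theorem coeff_step (K : Type*) [Field K] {n : ℕ} (W : Finset ℕ) (hW : eF n univ ∉ W)
    (z : Finset ℕ →₀ K) (hz : z ∈ cyclesOn K (inducedSC (sd (simplexC (n+1))) W) n)
    (p : Equiv.Perm (Fin (n+1))) (i : Fin n) (hp : z (FL p) = 0) : z (FL (p * sw i)) = 0 := by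
  obtain ⟨hz1, hz2⟩ := hz
  have hz1 := (mem_facesSpan_iff K _ _ z).1 hz1
  have hz2 := LinearMap.mem_ker.1 hz2
  by_contra hne
  set q := p * sw i with hq
  have hv : eF n (Qf q i) ∈ FL q := mem_image_of_mem _ (mem_range.2 i.2)
  set R := (FL q).erase (eF n (Qf q i)) with hR
  have := bdry_apply K z R
  rw [hz2, Finset.sum_eq_single (FL q)] at this
  · exact mul_ne_zero hne (bdryFace_apply_erase K (FL q) _ hv) this.symm
  · intro F hF hFq
    have hF0 := Finsupp.mem_support_iff.1 hF
    by_cases hRF : R ⊆ F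
    · exfalso
      obtain ⟨f1, f2⟩ := hz1 F hF0
      obtain ⟨r, rfl⟩ := face_eq_FL W F hW f1 (by exact_mod_cast f2)
      have : ∀ j < n, j ≠ i.val → Qf p j = Qf r j := by
        intro j hj hji
        rw [← Qf_sw p i j hji]
        apply Qf_eq_of_mem _ _ hj
        apply hRF
        rw [hR, mem_erase]
        refine ⟨fun h => hji ?_, mem_image_of_mem _ (mem_range.2 hj)⟩
        exact FLfun_injOn q (by simpa using hj) (by simp) h
      rcases ridge_flags p r i this with h | h
      · rw [h] at hF0; exact hF0 hp
      · exact hFq h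
    · rw [bdryFace_apply_ne K F R hRF, mul_zero]
  · intro h
    rw [Finsupp.notMem_support_iff.1 h, zero_mul]

theorem exists_flag_through {n : ℕ} (A : Finset (Fin (n+1))) (h1 : A.Nonempty) (h2 : A ≠ univ) :
    ∃ p : Equiv.Perm (Fin (n+1)), eF n A ∈ FL p := by
  have hc : A.card < n + 1 := by
    have h5 : A.card ≤ n + 1 := by simpa using Finset.card_le_univ A
    refine lt_of_le_of_ne h5 fun h => h2 ?_
    rw [← Finset.card_eq_iff_eq_univ]; simpa using h
  have hpos := card_pos.2 h1
  have hcc : A.card = (Qf (1 : Equiv.Perm (Fin (n+1))) (A.card - 1)).card := by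
    rw [card_Qf _ _ (by omega)]; omega
  obtain ⟨p, hp⟩ : ∃ p : Equiv.Perm (Fin (n+1)),
      ∀ x, p x ∈ A ↔ x ∈ Qf (1 : Equiv.Perm (Fin (n+1))) (A.card - 1) := by
    have e : {x // x ∈ Qf (1 : Equiv.Perm (Fin (n+1))) (A.card - 1)} ≃ {x // x ∈ A} :=
      Finset.equivOfCardEq hcc.symm
    refine ⟨e.extendSubtype, fun x => ?_⟩
    constructor
    · intro h
      by_contra hx
      exact e.extendSubtype_not_mem x hx h
    · intro hx; exact e.extendSubtype_mem x hx
  refine ⟨p, mem_image.2 ⟨A.card - 1, mem_range.2 (by omega), ?_⟩⟩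
  congr 1
  ext x
  have := hp (p.symm x)
  rw [Equiv.apply_symm_apply, mem_Qf] at this
  rw [mem_Qf, this]
  rfl

theorem redHdim_missing (K : Type*) [Field K] {n : ℕ} (W : Finset ℕ) (hW : eF n univ ∉ W)
    (A : Finset (Fin (n+1))) (h1 : A.Nonempty) (h2 : A ≠ univ) (hA : eF n A ∉ W) :
    redHdim K (inducedSC (sd (simplexC (n+1))) W) n = 0 := by
  have : cyclesOn K (inducedSC (sd (simplexC (n+1))) W) n = ⊥ := by
    rw [eq_bot_iff]
    intro z hz
    obtain ⟨p, hp⟩ := exists_flag_through A h1 h2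
    have hz1 := (mem_facesSpan_iff K _ _ z).1 hz.1
    have hp0 : z (FL p) = 0 := by
      by_contra h
      exact hA ((mem_filter.1 (hz1 _ h).1).2 hp)
    have hall : ∀ q : Equiv.Perm (Fin (n+1)), z (FL (p * q)) = 0 := by
      intro q
      have hq : q ∈ Submonoid.closure (Set.range fun i : Fin n ↦ Equiv.swap i.castSucc i.succ) := by
        rw [Equiv.Perm.mclosure_swap_castSucc_succ]; trivial
      induction hq using Submonoid.closure_induction_right with
      | one => simpa using hp0
      | mul_right x hx y hy ih =>
        obtain ⟨i, rfl⟩ := hy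
        rw [← mul_assoc]
        exact coeff_step K W hW z hz _ i ih
    rw [Submodule.mem_bot]
    ext F
    by_contra hF
    obtain ⟨f1, f2⟩ := hz1 F hF
    obtain ⟨r, rfl⟩ := face_eq_FL W F hW f1 (by exact_mod_cast f2)
    have := hall (p⁻¹ * r)
    rw [mul_inv_cancel_left] at this
    exact hF this
  unfold redHdim
  rw [this]
  simp

/-! the fundamental cycle -/

def invT (g : ℕ → ℕ) (S : Finset ℕ) : ℕ :=
  ((S ×ˢ S).filter (fun ab => ab.1 < ab.2 ∧ g ab.2 < g ab.1)).card

theorem invT_insert (g : ℕ → ℕ) (S : Finset ℕ) (i : ℕ) (hi : i ∉ S) :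
    invT g (insert i S) = invT g S + (S.filter (fun j => j < i ∧ g i < g j)).card
      + (S.filter (fun j => i < j ∧ g j < g i)).card := by
  unfold invT
  have e1 : (S.filter (fun j => j < i ∧ g i < g j)).card =
      ((S.filter (fun j => j < i ∧ g i < g j)).image (fun j => (j, i))).card := by
    rw [card_image_of_injective]; intro a b h; simpa using h
  have e2 : (S.filter (fun j => i < j ∧ g j < g i)).card =
      ((S.filter (fun j => i < j ∧ g j < g i)).image (fun j => (i, j))).card := by
    rw [card_image_of_injective]; intro a b h; simpa using h
  rw [e1, e2, ← card_union_of_disjoint, ← card_union_of_disjoint]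
  · congr 1
    ext ⟨a, b⟩
    simp only [mem_filter, mem_product, mem_insert, mem_union, mem_image, Prod.mk.injEq]
    constructor
    · rintro ⟨⟨rfl | ha, rfl | hb⟩, h1, h2⟩
      · omega
      · right; exact ⟨b, ⟨hb, h1, h2⟩, rfl, rfl⟩
      · left; right; exact ⟨a, ⟨ha, h1, h2⟩, rfl, rfl⟩
      · left; left; exact ⟨⟨ha, hb⟩, h1, h2⟩
    · rintro ((⟨⟨ha, hb⟩, h1, h2⟩ | ⟨j, ⟨hj, h1, h2⟩, rfl, rfl⟩) | ⟨j, ⟨hj, h1, h2⟩, rfl, rfl⟩)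
      · exact ⟨⟨Or.inr ha, Or.inr hb⟩, h1, h2⟩
      · exact ⟨⟨Or.inr hj, Or.inl rfl⟩, h1, h2⟩
      · exact ⟨⟨Or.inl rfl, Or.inr hj⟩, h1, h2⟩
  · rw [Finset.disjoint_left]
    rintro ⟨a, b⟩ h1 h2
    simp only [mem_filter, mem_product, mem_union, mem_image, Prod.mk.injEq] at h1 h2
    obtain ⟨j, ⟨hj, _⟩, rfl, rfl⟩ := h2
    rcases h1 with ⟨⟨ha, hb⟩, _⟩ | ⟨k, ⟨hk, _⟩, rfl, rfl⟩
    · exact hi ha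
    · exact hi hk
  · rw [Finset.disjoint_left]
    rintro ⟨a, b⟩ h1 h2
    simp only [mem_filter, mem_product, mem_image, Prod.mk.injEq] at h1 h2
    obtain ⟨j, ⟨hj, _⟩, rfl, rfl⟩ := h2
    exact hi h1.1.2

theorem invT_parity (K : Type*) [Field K] (g : ℕ → ℕ) (n i : ℕ) (hi : i < n)
    (hg : Set.InjOn g (range n : Set ℕ)) :
    (-1 : K) ^ (invT g (range n)) * (-1 : K) ^ (((range n).filter (fun j => g j < g i)).card) =
      (-1 : K) ^ (invT g ((range n).erase i)) * (-1 : K) ^ i := by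
  set S := (range n).erase i with hS
  have hins : range n = insert i S := by rw [hS, Finset.insert_erase (mem_range.2 hi)]
  have hiS : i ∉ S := by simp [hS]
  have hgne : ∀ j ∈ S, g j ≠ g i := by
    intro j hj h
    have := hg (by have := mem_of_mem_erase hj; simpa using this) (by simpa using hi) h
    exact hiS (this ▸ hj)
  have c1 : ((range n).filter (fun j => g j < g i)).card =
      (S.filter (fun j => j < i ∧ g j < g i)).card + (S.filter (fun j => i < j ∧ g j < g i)).card := by
    rw [← card_union_of_disjoint]
    · congr 1
      ext j
      rw [hins]
      simp only [mem_filter, mem_union, mem_insert]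
      constructor
      · rintro ⟨rfl | h1, h2⟩
        · omega
        · rcases lt_trichotomy j i with h | h | h
          · left; exact ⟨h1, h, h2⟩
          · exact absurd (h ▸ h1) hiS
          · right; exact ⟨h1, h, h2⟩
      · rintro (⟨h1, h, h2⟩ | ⟨h1, h, h2⟩) <;> exact ⟨Or.inr h1, h2⟩
    · rw [Finset.disjoint_left]
      intro j h1 h2
      simp only [mem_filter] at h1 h2
      omega
  have c2 : i = (S.filter (fun j => j < i ∧ g j < g i)).card +
      (S.filter (fun j => j < i ∧ g i < g j)).card := by
    rw [← card_union_of_disjoint]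
    · conv_lhs => rw [← card_range i]
      congr 1
      ext j
      simp only [mem_filter, mem_union, mem_range]
      constructor
      · intro h
        have hj : j ∈ S := by rw [hS, mem_erase, mem_range]; omega
        rcases lt_or_gt_of_ne (hgne j hj) with h' | h'
        · left; exact ⟨hj, h, h'⟩
        · right; exact ⟨hj, h, h'⟩
      · rintro (⟨h1, h, h2⟩ | ⟨h1, h, h2⟩) <;> exact h
    · rw [Finset.disjoint_left]
      intro j h1 h2
      simp only [mem_filter] at h1 h2
      omega
  have c3 := invT_insert g S i hiS
  rw [← hins] at c3
  rw [c3, c1]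
  conv_rhs => rw [c2]
  set a := (S.filter (fun j => j < i ∧ g i < g j)).card
  set b := (S.filter (fun j => i < j ∧ g j < g i)).card
  set c := (S.filter (fun j => j < i ∧ g j < g i)).card
  have : (-1 : K) ^ b * (-1 : K) ^ b = 1 := by rw [← pow_add, ← two_mul, pow_mul]; simp
  calc _ = (-1 : K) ^ (invT g S) * (-1 : K) ^ a * (-1 : K) ^ c * ((-1 : K) ^ b * (-1 : K) ^ b) := by ring
    _ = _ := by rw [this]; ring

def gf {n : ℕ} (p : Equiv.Perm (Fin (n+1))) (j : ℕ) : ℕ := eF n (Qf p j)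

def fterm (K : Type*) [Field K] {n : ℕ} (p : Equiv.Perm (Fin (n+1))) (j : ℕ) : Finset ℕ →₀ K :=
  (((Equiv.Perm.sign p : ℤ) : K) * ((-1 : K) ^ (invT (gf p) ((range n).erase j)) * (-1 : K) ^ j)) •
    Finsupp.single (((range n).erase j).image (gf p)) (1 : K)

def fundC (K : Type*) [Field K] (n : ℕ) : Finset ℕ →₀ K :=
  ∑ p : Equiv.Perm (Fin (n+1)),
    (((Equiv.Perm.sign p : ℤ) : K) * (-1 : K) ^ (invT (gf p) (range n))) • Finsupp.single (FL p) (1 : K)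

theorem gf_injOn {n : ℕ} (p : Equiv.Perm (Fin (n+1))) : Set.InjOn (gf p) (range n : Set ℕ) :=
  FLfun_injOn p

theorem bdry_FL (K : Type*) [Field K] {n : ℕ} (p : Equiv.Perm (Fin (n+1))) :
    (((Equiv.Perm.sign p : ℤ) : K) * (-1 : K) ^ (invT (gf p) (range n))) • bdryFace K (FL p) =
      ∑ j ∈ range n, fterm K p j := by
  have hFL : FL p = (range n).image (gf p) := rfl
  unfold bdryFace
  rw [hFL, Finset.sum_image (gf_injOn p), Finset.smul_sum]
  apply Finset.sum_congr rfl
  intro j hj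
  have hj' := mem_range.1 hj
  unfold fterm
  rw [smul_smul, mul_assoc]
  have e1 : ((range n).image (gf p)).erase (gf p j) = ((range n).erase j).image (gf p) := by
    ext x
    simp only [mem_erase, mem_image]
    constructor
    · rintro ⟨h1, k, hk, rfl⟩
      exact ⟨k, ⟨fun h => h1 (h ▸ rfl), hk⟩, rfl⟩
    · rintro ⟨k, ⟨h1, hk⟩, rfl⟩
      exact ⟨fun h => h1 (gf_injOn p hk hj h), k, hk, rfl⟩
  have e2 : (((range n).image (gf p)).filter (fun w => w < gf p j)).card =
      ((range n).filter (fun k => gf p k < gf p j)).card := by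
    rw [Finset.filter_image, card_image_of_injOn]
    exact (gf_injOn p).mono (by intro x hx; exact (mem_filter.1 hx).1)
  rw [e1, e2, invT_parity K (gf p) n j hj' (gf_injOn p)]

theorem invT_congr (g g' : ℕ → ℕ) (S : Finset ℕ) (h : ∀ j ∈ S, g j = g' j) :
    invT g S = invT g' S := by
  unfold invT
  congr 1
  apply Finset.filter_congr
  rintro ⟨a, b⟩ hab
  rw [mem_product] at hab
  rw [h a hab.1, h b hab.2]

theorem fterm_sw (K : Type*) [Field K] {n : ℕ} (p : Equiv.Perm (Fin (n+1))) (i : Fin n) :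
    fterm K p i + fterm K (p * sw i) i = 0 := by
  have hg : ∀ j ∈ (range n).erase i.val, gf (p * sw i) j = gf p j := by
    intro j hj
    unfold gf
    rw [Qf_sw p i j (mem_erase.1 hj).1]
  have hs : Equiv.Perm.sign (p * sw i) = - Equiv.Perm.sign p := by
    rw [Equiv.Perm.sign_mul, sw, Equiv.Perm.sign_swap]
    · simp
    · exact (Fin.castSucc_lt_succ).ne
  unfold fterm
  rw [invT_congr _ _ _ hg, Finset.image_congr (s := (range n).erase i.val) (f := gf (p * sw i)) (g := gf p) (fun j hj => hg j hj),
    ← add_smul, hs]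
  convert zero_smul K _
  push_cast
  ring

theorem sum_fterm (K : Type*) [Field K] {n : ℕ} (i : Fin n) :
    ∑ p : Equiv.Perm (Fin (n+1)), fterm K p i = 0 := by
  apply Finset.sum_involution (fun p _ => p * sw i)
  · intro p _; exact fterm_sw K p i
  · intro p _ _ h
    have h2 : sw i = 1 := by simpa using h
    have := sw_val i i.castSucc
    rw [h2] at this
    simp at this
  · intro p _; exact mem_univ _
  · intro p _
    rw [mul_assoc, sw, Equiv.swap_mul_self, mul_one]

theorem fundC_cycle (K : Type*) [Field K] (n : ℕ) : bdry K (fundC K n) = 0 := by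
  unfold fundC
  rw [map_sum]
  simp only [map_smul, bdry_single, one_smul, bdry_FL]
  rw [Finset.sum_comm]
  apply Finset.sum_eq_zero
  intro j hj
  exact sum_fterm K ⟨j, mem_range.1 hj⟩

theorem fundC_ne (K : Type*) [Field K] (n : ℕ) : fundC K n ≠ 0 := by
  intro h
  have := congrArg (fun z => z (FL (1 : Equiv.Perm (Fin (n+1))))) h
  simp only [fundC, Finsupp.finsetSum_apply] at this
  rw [Finset.sum_eq_single 1] at this
  · simp at this
  · intro q _ hq
    have : FL q ≠ FL 1 := fun h => hq (FL_injective h)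
    simp [Finsupp.single_apply, this]
  · simp

theorem redHdim_sphere (K : Type*) [Field K] (n : ℕ) (W : Finset ℕ) (hW : eF n univ ∉ W)
    (hall : ∀ A : Finset (Fin (n+1)), A.Nonempty → A ≠ univ → eF n A ∈ W) :
    redHdim K (inducedSC (sd (simplexC (n+1))) W) n ≠ 0 := by
  have hb : facesSpan K (inducedSC (sd (simplexC (n+1))) W) ((n : ℤ) + 1) = ⊥ := by
    rw [eq_bot_iff]
    intro z hz
    rw [mem_facesSpan_iff] at hz
    rw [Submodule.mem_bot]
    ext F
    by_contra hF
    obtain ⟨f1, f2⟩ := hz F hF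
    obtain ⟨h1, h2⟩ := mem_filter.1 f1
    obtain ⟨C, c1, c2, rfl⟩ := (mem_sd_iff n F).1 h1
    rw [card_image_of_injective _ (eF_inj n)] at f2
    have := chain_card_le C c1 c2 (fun h => hW (h2 (mem_image_of_mem _ h)))
    omega
  have hfin : Module.Finite K (facesSpan K (inducedSC (sd (simplexC (n+1))) W) n) := by
    unfold facesSpan
    apply FiniteDimensional.span_of_finite
    apply Set.Finite.image
    apply Set.Finite.subset (Finset.finite_toSet (inducedSC (sd (simplexC (n+1))) W))
    intro s hs
    exact hs.1
  have hmem : fundC K n ∈ cyclesOn K (inducedSC (sd (simplexC (n+1))) W) n := by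
    refine ⟨?_, LinearMap.mem_ker.2 (fundC_cycle K n)⟩
    apply Submodule.sum_mem
    intro p _
    apply Submodule.smul_mem
    apply Submodule.subset_span
    refine ⟨FL p, ⟨mem_filter.2 ⟨FL_mem_sd p, ?_⟩, by rw [card_FL]⟩, rfl⟩
    intro x hx
    obtain ⟨j, hj, rfl⟩ := mem_image.1 hx
    have hj := mem_range.1 hj
    apply hall
    · exact ⟨p 0, by simp [mem_Qf]⟩
    · intro h
      have := card_Qf p j (by omega)
      rw [h] at this
      simp at this
      omega
  have hfin2 : Module.Finite K (cyclesOn K (inducedSC (sd (simplexC (n+1))) W) n) :=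
    Submodule.finiteDimensional_of_le (inf_le_left : cyclesOn K _ _ ≤ _)
  unfold redHdim boundariesOn
  rw [hb, Submodule.map_bot, bot_inf_eq, finrank_bot, Nat.sub_zero]
  intro h
  have h0 := (Submodule.finrank_eq_zero (R := K)).1 h
  rw [h0] at hmem
  exact fundC_ne K n ((Submodule.mem_bot K).1 hmem)

theorem redHdim_top (K : Type*) [Field K] (n : ℕ) (W : Finset ℕ) (hW : eF n univ ∈ W) (m : ℤ) :
    redHdim K (inducedSC (sd (simplexC (n+1))) W) m = 0 := by
  apply redHdim_cone K _ (eF n univ)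
  intro s hs
  obtain ⟨h1, h2⟩ := mem_filter.1 hs
  obtain ⟨C, c1, c2, rfl⟩ := (mem_sd_iff n s).1 h1
  refine mem_filter.2 ⟨(mem_sd_iff n _).2 ⟨insert univ C, ?_, ?_, by rw [Finset.image_insert]⟩, ?_⟩
  · intro A hA
    rcases mem_insert.1 hA with rfl | hA
    · exact univ_nonempty
    · exact c1 A hA
  · intro A hA B hB
    rcases mem_insert.1 hA with rfl | hA
    · right; exact subset_univ _
    · rcases mem_insert.1 hB with rfl | hB
      · left; exact subset_univ _
      · exact c2 A hA B hB
  · exact insert_subset hW h2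

theorem betti_iff (K : Type*) [Field K] (n i : ℕ) :
    bettiSR K (sd (simplexC (n+1))) i (i + n) ≠ 0 ↔ i + n = 2 ^ (n+1) - 2 := by
  have hcast : (((i + n : ℕ) : ℤ) - i) = n := by push_cast; ring
  unfold bettiSR
  rw [hcast, Ne, Finset.sum_eq_zero_iff]
  push Not
  have hV := card_vertexSet_sd n
  have hVm : ∀ A : Finset (Fin (n+1)), A.Nonempty → eF n A ∈ vertexSet (sd (simplexC (n+1))) := by
    intro A hA
    rw [vertexSet_sd]
    exact mem_image_of_mem _ (mem_erase.2 ⟨hA.ne_empty, mem_univ _⟩)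
  have hce : ((vertexSet (sd (simplexC (n+1)))).erase (eF n univ)).card = 2 ^ (n+1) - 2 := by
    rw [card_erase_of_mem (hVm _ univ_nonempty), hV]; omega
  constructor
  · rintro ⟨W, hW, hne⟩
    obtain ⟨hW1, hW2⟩ := mem_filter.1 hW
    rw [mem_powerset] at hW1
    have ht : eF n univ ∉ W := fun h => hne (redHdim_top K n W h _)
    have : W = (vertexSet (sd (simplexC (n+1)))).erase (eF n univ) := by
      apply Finset.Subset.antisymm
      · intro x hx
        exact mem_erase.2 ⟨fun h => ht (h ▸ hx), hW1 hx⟩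
      · intro x hx
        obtain ⟨h1, h2⟩ := mem_erase.1 hx
        rw [vertexSet_sd] at h2
        obtain ⟨A, hA, rfl⟩ := mem_image.1 h2
        by_contra hxW
        exact hne (redHdim_missing K W ht A (Finset.nonempty_iff_ne_empty.2 (mem_erase.1 hA).1)
          (fun h => h1 (h ▸ rfl)) hxW)
    rw [← hW2, this, hce]
  · intro h
    obtain ⟨U, hU⟩ : ∃ U, U = (vertexSet (sd (simplexC (n+1)))).erase (eF n univ) := ⟨_, rfl⟩
    have hsub : U ⊆ vertexSet (sd (simplexC (n+1))) := by
      intro x hx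
      rw [hU] at hx
      exact mem_of_mem_erase hx
    refine ⟨U, ?_, ?_⟩
    · rw [mem_filter, mem_powerset]
      exact ⟨hsub, by rw [hU, hce, h]⟩
    · apply redHdim_sphere
      · rw [hU]; exact notMem_erase _ _
      · intro A h1 h2
        rw [hU]
        exact mem_erase.2 ⟨fun h => h2 (eF_inj n h), hVm A h1⟩

end

/-- `β_{i,i+d-1}(K[sd(Δ_{d-1})]) ≠ 0` if and only if `i = 2^d - d - 1`. -/
theorem statement_2 (K : Type*) [Field K] (d : ℕ) (hd : 1 ≤ d) (i : ℕ) :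
    bettiSR K (sd (simplexC d)) i (i + (d - 1)) ≠ 0 ↔ i = 2 ^ d - d - 1 := by
  obtain ⟨n, rfl⟩ : ∃ n, d = n + 1 := ⟨d - 1, by omega⟩
  rw [Nat.add_sub_cancel, betti_iff]
  have : n + 1 < 2 ^ (n + 1) := Nat.lt_two_pow_self
  omega
end

section
/- For all integers d ≥ 1 and 1 ≤ j ≤ d-1, one has m_j(d) + j = min{ Σ_{ℓ=1}^r (2^{i_ℓ+2} - 2) : r ≥ 1, (i_1,…,i_r) ∈ ℕ^r, i_1+⋯+i_r+(r-1) = j-1, and i_1+⋯+i_r+2r ≤ d }. -/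
open Finset BigOperators

theorem aux_tangent (a i : ℕ) : (2:ℤ)^(a+2) * (1 + i - a) ≤ (2:ℤ)^(i+2) := by
  rcases le_total a i with h | h
  · obtain ⟨k, rfl⟩ := Nat.exists_eq_add_of_le h
    have h1 : (k:ℤ) + 1 ≤ 2^k := by exact_mod_cast Nat.lt_two_pow_self (n := k)
    have h2 : (2:ℤ)^(a+k+2) = 2^(a+2) * 2^k := by ring
    rw [h2]
    apply mul_le_mul_of_nonneg_left _ (by positivity)
    push_cast
    linarith
  · rcases Nat.eq_or_lt_of_le h with rfl | h
    · simp
    · have h1 : (1 + i - a : ℤ) ≤ 0 := by omega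
      have h2 : (0:ℤ) ≤ 2^(a+2) := by positivity
      have h3 : (0:ℤ) ≤ 2^(i+2) := by positivity
      nlinarith

theorem aux_sum (c m A B : ℕ) :
    ∑ l ∈ Finset.Icc 1 (c+m), (if l ≤ c then A else B) = c * A + m * B := by
  induction m with
  | zero =>
    rw [Finset.sum_congr rfl (g := fun _ => A)]
    · simp
    · intro x hx
      simp at hx
      simp [hx.2]
  | succ m ih =>
    rw [← add_assoc, Finset.sum_Icc_succ_top (by omega), ih, if_neg (by omega)]
    ring

theorem aux_cast (r : ℕ) (iv : ℕ → ℕ) :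
    ((∑ l ∈ Finset.Icc 1 r, (2 ^ (iv l + 2) - 2) : ℕ) : ℤ)
      = ∑ l ∈ Finset.Icc 1 r, (2:ℤ) ^ (iv l + 2) - 2 * r := by
  have : ∀ l, (((2 ^ (iv l + 2) - 2 : ℕ)) : ℤ) = (2:ℤ) ^ (iv l + 2) - 2 := by
    intro l
    have : 2 ≤ 2 ^ (iv l + 2) := by
      have := Nat.one_le_two_pow (n := iv l)
      rw [pow_add]; omega
    push_cast [Nat.cast_sub this]
    ring
  rw [Nat.cast_sum, Finset.sum_congr rfl (fun l _ => this l)]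
  simp [Finset.sum_sub_distrib, mul_comm]

theorem aux_lower (a r : ℕ) (iv : ℕ → ℕ) :
    (2:ℤ)^(a+2) * (r + ((∑ l ∈ Finset.Icc 1 r, iv l : ℕ) : ℤ) - a * r) - 2 * r ≤
    ((∑ l ∈ Finset.Icc 1 r, (2 ^ (iv l + 2) - 2) : ℕ) : ℤ) := by
  rw [aux_cast]
  have := Finset.sum_le_sum (s := Finset.Icc 1 r) (fun l _ => aux_tangent a (iv l))
  rw [← Finset.mul_sum] at this
  simp only [Finset.sum_sub_distrib, Finset.sum_add_distrib] at this
  simp at this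
  push_cast
  linarith [mul_comm (a:ℤ) r]

/-- `m_j(d) + j` is the minimum of `Σ_{ℓ=1}^r (2^{i_ℓ+2} - 2)` over all
`r ≥ 1` and tuples `(i_1,…,i_r) ∈ ℕ^r` with `i_1+⋯+i_r+(r-1) = j-1` and
`i_1+⋯+i_r+2r ≤ d`. -/
theorem statement_3 (d j : ℕ) (hd : 1 ≤ d) (hj1 : 1 ≤ j) (hj2 : j ≤ d - 1) :
    IsLeast { m : ℕ | ∃ r : ℕ, 1 ≤ r ∧ ∃ iv : ℕ → ℕ,
      (∑ l ∈ Finset.Icc 1 r, iv l) + (r - 1) = j - 1 ∧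
      (∑ l ∈ Finset.Icc 1 r, iv l) + 2 * r ≤ d ∧
      m = ∑ l ∈ Finset.Icc 1 r, (2 ^ (iv l + 2) - 2) }
    (mj d j + j) := by
  unfold mj
  split_ifs with h
  · constructor
    · refine ⟨j, hj1, fun _ => 0, ?_, ?_, ?_⟩
      · simp
      · simp; omega
      · simp; omega
    · rintro m ⟨r, hr, iv, h1, h2, rfl⟩
      have := aux_lower 0 r iv
      generalize (∑ l ∈ Finset.Icc 1 r, (2 ^ (iv l + 2) - 2) : ℕ) = T at this ⊢
      simp only [Nat.cast_zero, zero_mul, zero_add] at this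
      omega
  · obtain ⟨n, rfl⟩ : ∃ n, d = j + n := ⟨d - j, by omega⟩
    have hn : 0 < n := by omega
    rw [show j + n - j = n by omega]
    set a := (2 * j - (j + n)) / n with ha
    set c := (2 * j - (j + n)) % n with hc
    have hcn : c < n := Nat.mod_lt _ hn
    have hdiv : n * a + c = 2 * j - (j + n) := Nat.div_add_mod _ _
    have hj : j = n * a + c + n := by omega
    have hval : ((2 ^ (a + 2) * (c + n) + j - 2 * (j + n) + j : ℕ) : ℤ)
        = 2 ^ (a+2) * (c + n) - 2 * n := by
      have hb : 2 * (j + n) ≤ 2 ^ (a + 2) * (c + n) + j := by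
        have h1 : a + 1 ≤ 2 ^ a := Nat.lt_two_pow_self
        rw [hj, pow_add]
        nlinarith [Nat.mul_le_mul_right (c + n) h1, Nat.zero_le (a * c)]
      push_cast [Nat.cast_sub hb]
      ring
    constructor
    · obtain ⟨m, hm⟩ : ∃ m, n = c + m := ⟨n - c, by omega⟩
      have hs : ∑ l ∈ Finset.Icc 1 n, (if l ≤ c then a + 1 else a) = n * a + c := by
        rw [hm, aux_sum]; ring
      refine ⟨n, hn, fun l => if l ≤ c then a + 1 else a, ?_, ?_, ?_⟩
      · simp only [hs]; omega
      · simp only [hs]; omega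
      · zify
        have h3 := aux_cast n (fun l => if l ≤ c then a + 1 else a)
        have h4 : ∑ l ∈ Finset.Icc 1 n, (2:ℤ) ^ ((if l ≤ c then a + 1 else a) + 2)
            = 2 ^ (a+2) * (c + n) := by
          have h5 := aux_sum c m (2 ^ (a+1+2)) (2 ^ (a+2))
          rw [← hm] at h5
          have h6 : ∀ l ∈ Finset.Icc 1 n, (2:ℤ) ^ ((if l ≤ c then a + 1 else a) + 2)
              = ((if l ≤ c then 2 ^ (a+1+2) else 2 ^ (a+2) : ℕ) : ℤ) := by
            intro l _
            split_ifs <;> simp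
          rw [Finset.sum_congr rfl h6, ← Nat.cast_sum, h5, hm]
          push_cast
          ring
        have h7 := hval.trans ((congrArg (· - 2 * (n:ℤ)) h4.symm).trans h3.symm)
        exact_mod_cast h7
    · rintro m ⟨r, hr, iv, h1, h2, rfl⟩
      have h3 := aux_lower a r iv
      have hS : ((∑ l ∈ Finset.Icc 1 r, iv l : ℕ) : ℤ) = j - r := by omega
      have hrn : (r:ℤ) ≤ n := by omega
      rw [hS] at h3
      have hjz : (j:ℤ) = n * a + c + n := by exact_mod_cast hj
      have h8 : (0:ℤ) ≤ 2 ^ (a+2) * (a * (n - r)) := by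
        have : (0:ℤ) ≤ n - r := by omega
        positivity
      zify
      have h9 : ((2 ^ (a + 2) * (c + n) + j - 2 * (j + n) + j : ℕ) : ℤ) ≤
          ((∑ l ∈ Finset.Icc 1 r, (2 ^ (iv l + 2) - 2) : ℕ) : ℤ) := by
        rw [hval]
        refine le_trans ?_ h3
        rw [hjz]
        linarith
      exact_mod_cast h9
end

section
/- Let Δ be a (d-1)-dimensional flag simplicial complex, let j ≥ 0, and let z be a j-cycle of the reduced simplicial chain complex of Δ over a field K which is not a boundary (i.e. z lies in the kernel of the boundary map ∂_j but not in the image of ∂_{j+1}). Then the union of the vertex sets of the simplices in the support of z contains at least 2(j+1) vertices. -/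
open Finset BigOperators

namespace FlagAux
open Finset

variable (K : Type*) [Field K]

noncomputable def sg (v : ℕ) (s : Finset ℕ) : K := (-1 : K) ^ ((s.filter (fun w => w < v)).card)

lemma sg_sq (v : ℕ) (s : Finset ℕ) : sg K v s * sg K v s = 1 := by
  unfold sg
  rw [← mul_pow]; simp

lemma sg_insert_lt {u v : ℕ} {s : Finset ℕ} (hu : u ∉ s) (h : u < v) :
    sg K v (insert u s) = - sg K v s := by
  unfold sg
  rw [Finset.filter_insert, if_pos h, Finset.card_insert_of_notMem (by simp [hu]), pow_succ]
  ring

lemma sg_insert_ge {u v : ℕ} {s : Finset ℕ} (h : ¬ u < v) :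
    sg K v (insert u s) = sg K v s := by
  unfold sg
  rw [Finset.filter_insert, if_neg h]

lemma sg_erase_lt {u v : ℕ} {s : Finset ℕ} (hu : u ∈ s) (h : u < v) :
    sg K v (s.erase u) = - sg K v s := by
  have := sg_insert_lt K (Finset.notMem_erase u s) h
  rw [Finset.insert_erase hu] at this
  rw [this]; ring

lemma sg_erase_ge {u v : ℕ} {s : Finset ℕ} (hu : u ∈ s) (h : ¬ u < v) :
    sg K v (s.erase u) = sg K v s := by
  have := sg_insert_ge K (s := s.erase u) h
  rw [Finset.insert_erase hu] at this
  rw [this]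

noncomputable def iF (v : ℕ) (s : Finset ℕ) : Finset ℕ →₀ K :=
  if v ∈ s then Finsupp.single (s.erase v) (sg K v s) else 0

noncomputable def eF (v : ℕ) (s : Finset ℕ) : Finset ℕ →₀ K :=
  if v ∈ s then 0 else Finsupp.single (insert v s) (sg K v s)

noncomputable def iO (v : ℕ) : (Finset ℕ →₀ K) →ₗ[K] (Finset ℕ →₀ K) :=
  Finsupp.lsum K fun s => LinearMap.toSpanSingleton K (Finset ℕ →₀ K) (iF K v s)

noncomputable def eO (v : ℕ) : (Finset ℕ →₀ K) →ₗ[K] (Finset ℕ →₀ K) :=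
  Finsupp.lsum K fun s => LinearMap.toSpanSingleton K (Finset ℕ →₀ K) (eF K v s)

lemma iO_single (v : ℕ) (s : Finset ℕ) (a : K) :
    iO K v (Finsupp.single s a) = if v ∈ s then Finsupp.single (s.erase v) (a * sg K v s) else 0 := by
  simp only [iO, iF, Finsupp.lsum_single, LinearMap.toSpanSingleton_apply]
  split_ifs <;> simp

lemma eO_single (v : ℕ) (s : Finset ℕ) (a : K) :
    eO K v (Finsupp.single s a) =
      if v ∈ s then 0 else Finsupp.single (insert v s) (a * sg K v s) := by
  simp only [eO, eF, Finsupp.lsum_single, LinearMap.toSpanSingleton_apply]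
  split_ifs <;> simp

lemma bdry_single (s : Finset ℕ) (a : K) :
    bdry K (Finsupp.single s a) = ∑ u ∈ s, iO K u (Finsupp.single s a) := by
  simp only [bdry, bdryFace, Finsupp.lsum_single, LinearMap.toSpanSingleton_apply, Finset.smul_sum]
  refine Finset.sum_congr rfl fun u hu => ?_
  rw [iO_single, if_pos hu]
  simp [sg]

lemma ie_eq (v : ℕ) (s : Finset ℕ) :
    iO K v (eO K v (Finsupp.single s 1)) = if v ∈ s then 0 else Finsupp.single s 1 := by
  rw [eO_single]
  split_ifs with h
  · simp
  · rw [iO_single, if_pos (by simp), Finset.erase_insert h, sg_insert_ge K (lt_irrefl v), one_mul,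
      sg_sq]

lemma ei_eq (v : ℕ) (s : Finset ℕ) :
    eO K v (iO K v (Finsupp.single s 1)) = if v ∈ s then Finsupp.single s 1 else 0 := by
  rw [iO_single]
  split_ifs with h
  · rw [eO_single, if_neg (by simp), Finset.insert_erase h, sg_erase_ge K h (lt_irrefl v), one_mul,
      sg_sq]
  · simp

lemma ei_ne {u v : ℕ} (huv : u ≠ v) (s : Finset ℕ) :
    iO K u (eO K v (Finsupp.single s 1)) + eO K v (iO K u (Finsupp.single s 1)) = 0 := by
  rw [eO_single, iO_single]
  by_cases hv : v ∈ s <;> by_cases hu : u ∈ s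
  · rw [if_pos hv, if_pos hu, eO_single, if_pos (by simp [hv, huv.symm])]; simp
  · simp [hv, hu]
  · rw [if_neg hv, if_pos hu, iO_single, eO_single, if_pos (by simp [hu]), if_neg (by simp [hv]),
      Finset.erase_insert_of_ne huv.symm, ← Finsupp.single_add]
    rw [Finsupp.single_eq_zero]
    rcases lt_or_gt_of_ne huv with h | h
    · rw [sg_insert_ge K h.not_gt, sg_erase_lt K hu h]; ring
    · rw [sg_insert_lt K hv h, sg_erase_ge K hu h.not_gt]; ring
  · rw [if_neg hv, if_neg hu, iO_single, if_neg (by simp [hu, huv])]; simp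

lemma ii_self (v : ℕ) (s : Finset ℕ) : iO K v (iO K v (Finsupp.single s 1)) = 0 := by
  rw [iO_single]
  split_ifs with h
  · rw [iO_single, if_neg (by simp)]
  · simp

lemma ii_ne {u v : ℕ} (huv : u ≠ v) (s : Finset ℕ) :
    iO K u (iO K v (Finsupp.single s 1)) + iO K v (iO K u (Finsupp.single s 1)) = 0 := by
  wlog h : u < v generalizing u v
  · rw [add_comm]; exact this huv.symm (by omega)
  rw [iO_single, iO_single]
  by_cases hv : v ∈ s <;> by_cases hu : u ∈ s
  · rw [if_pos hv, if_pos hu, iO_single, iO_single, if_pos (by simp [hu, huv]),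
      if_pos (by simp [hv, huv.symm]), Finset.erase_right_comm, ← Finsupp.single_add,
      Finsupp.single_eq_zero, sg_erase_ge K hv h.not_gt, sg_erase_lt K hu h]
    ring
  · rw [if_pos hv, if_neg hu, iO_single, if_neg (by simp [hu])]; simp
  · rw [if_neg hv, if_pos hu, iO_single, if_neg (by simp [hv])]; simp
  · simp [hv, hu]

lemma bdry_eO (v : ℕ) (z : Finset ℕ →₀ K) : bdry K (eO K v z) + eO K v (bdry K z) = z := by
  have : bdry K ∘ₗ eO K v + eO K v ∘ₗ bdry K = LinearMap.id := by
    ext1 s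
    ext1
    simp only [LinearMap.comp_apply, LinearMap.add_apply, Finsupp.lsingle_apply, LinearMap.id_apply]
    rw [bdry_single, map_sum]
    by_cases hv : v ∈ s
    · rw [← Finset.add_sum_erase _ _ hv, ei_eq, if_pos hv, eO_single, if_pos hv, map_zero, zero_add,
        Finset.sum_eq_zero, add_zero]
      intro u hu
      have h := ei_ne K (Finset.ne_of_mem_erase hu) s
      rw [eO_single, if_pos hv, map_zero, zero_add] at h
      exact h
    · have h1 : bdry K (eO K v (Finsupp.single s 1)) =
          ∑ u ∈ insert v s, iO K u (eO K v (Finsupp.single s 1)) := by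
        rw [eO_single, if_neg hv, bdry_single]
      rw [h1, Finset.sum_insert hv, ie_eq, if_neg hv, add_assoc, ← Finset.sum_add_distrib,
        Finset.sum_eq_zero, add_zero]
      intro u hu
      have huv : u ≠ v := fun h => hv (h ▸ hu)
      exact ei_ne K huv s
  exact DFunLike.congr_fun this z

lemma bdry_iO (v : ℕ) (z : Finset ℕ →₀ K) : bdry K (iO K v z) + iO K v (bdry K z) = 0 := by
  have : bdry K ∘ₗ iO K v + iO K v ∘ₗ bdry K = 0 := by
    ext1 s
    ext1
    simp only [LinearMap.comp_apply, LinearMap.add_apply, Finsupp.lsingle_apply,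
      LinearMap.zero_apply]
    rw [bdry_single, map_sum]
    by_cases hv : v ∈ s
    · have h1 : bdry K (iO K v (Finsupp.single s 1)) =
          ∑ u ∈ s.erase v, iO K u (iO K v (Finsupp.single s 1)) := by
        rw [iO_single, if_pos hv, bdry_single]
      rw [← Finset.add_sum_erase _ _ hv, ii_self, zero_add, h1, ← Finset.sum_add_distrib]
      refine Finset.sum_eq_zero fun u hu => ii_ne K (Finset.ne_of_mem_erase hu) s
    · rw [iO_single, if_neg hv, map_zero, zero_add]
      refine Finset.sum_eq_zero fun u hu => ?_
      have huv : u ≠ v := fun h => hv (h ▸ hu)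
      have h := ii_ne K huv s
      rw [iO_single K v, if_neg hv, map_zero, zero_add] at h
      exact h
  exact DFunLike.congr_fun this z

lemma map_supp {S T : Set (Finset ℕ)} (f : (Finset ℕ →₀ K) →ₗ[K] (Finset ℕ →₀ K))
    (h : ∀ s ∈ S, f (Finsupp.single s 1) ∈ Finsupp.supported K K T) {z : Finset ℕ →₀ K}
    (hz : z ∈ Finsupp.supported K K S) : f z ∈ Finsupp.supported K K T := by
  rw [Finsupp.supported_eq_span_single] at hz
  have : Submodule.span K ((fun i => Finsupp.single i (1 : K)) '' S) ≤
      (Finsupp.supported K K T).comap f := by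
    rw [Submodule.span_le]
    rintro _ ⟨s, hs, rfl⟩
    exact h s hs
  exact this hz

def cl (r : ℕ → ℕ → Prop) (W : Finset ℕ) (n : ℕ) : Set (Finset ℕ) :=
  {s | s ⊆ W ∧ s.card = n ∧ ∀ u ∈ s, ∀ w ∈ s, u ≠ w → r u w}

lemma cl_mono (r : ℕ → ℕ → Prop) {V W : Finset ℕ} (h : V ⊆ W) (n : ℕ) : cl r V n ⊆ cl r W n :=
  fun _ hs => ⟨hs.1.trans h, hs.2⟩

lemma cl_insert {r : ℕ → ℕ → Prop} (hr : ∀ u w, r u w → r w u) {W N : Finset ℕ} {v n : ℕ}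
    (hv : v ∈ W) (hN : ∀ w ∈ N, w ∈ W ∧ w ≠ v → r v w) (hNW : N ⊆ W) {s : Finset ℕ} (hvs : v ∉ s)
    (hs : s ∈ cl r N n) : insert v s ∈ cl r W (n + 1) := by
  obtain ⟨h1, h2, h3⟩ := hs
  have key : ∀ w ∈ s, r v w := fun w hw =>
    hN w (h1 hw) ⟨hNW (h1 hw), fun h => hvs (h ▸ hw)⟩
  refine ⟨?_, by rw [Finset.card_insert_of_notMem hvs, h2], ?_⟩
  · exact Finset.insert_subset hv (h1.trans hNW)
  · intro a ha b hb hab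
    rcases Finset.mem_insert.1 ha with ha | ha <;> rcases Finset.mem_insert.1 hb with hb | hb
    · exact absurd (ha.trans hb.symm) hab
    · rw [ha]; exact key b hb
    · rw [hb]; exact hr _ _ (key a ha)
    · exact h3 a ha b hb hab

lemma eO_supp {r : ℕ → ℕ → Prop} (hr : ∀ u w, r u w → r w u) {W N : Finset ℕ} {v n : ℕ}
    (hv : v ∈ W) (hN : ∀ w ∈ N, w ∈ W ∧ w ≠ v → r v w) (hNW : N ⊆ W) {z : Finset ℕ →₀ K}
    (hz : z ∈ Finsupp.supported K K (cl r N n)) :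
    eO K v z ∈ Finsupp.supported K K (cl r W (n + 1)) := by
  refine map_supp K _ (fun s hs => ?_) hz
  rw [eO_single]
  split_ifs with h
  · exact zero_mem _
  · exact Finsupp.single_mem_supported K _ (cl_insert hr hv hN hNW h hs)

theorem fill (r : ℕ → ℕ → Prop) (hr : ∀ u w, r u w → r w u) :
    ∀ (m : ℕ) (W : Finset ℕ) (n : ℕ) (z : Finset ℕ →₀ K), W.card = m → m < 2 * n →
      z ∈ Finsupp.supported K K (cl r W n) → bdry K z = 0 →
      ∃ c ∈ Finsupp.supported K K (cl r W (n + 1)), bdry K c = z := by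
  classical
  intro m
  induction m using Nat.strong_induction_on with
  | _ m ih =>
  intro W n z hWm hmn hz hbz
  rcases W.eq_empty_or_nonempty with rfl | ⟨v, hv⟩
  · have : cl r ∅ n = ∅ := by
      ext s
      simp only [cl, Finset.subset_empty, Set.mem_ofPred_eq, Set.mem_empty_iff_false, iff_false]
      rintro ⟨rfl, h, -⟩
      simp at h
      omega
    rw [this, Finsupp.supported_empty, Submodule.mem_bot] at hz
    exact ⟨0, zero_mem _, by simp [hz]⟩
  by_cases hall : ∀ w ∈ W, w ∈ W ∧ w ≠ v → r v w
  · refine ⟨eO K v z, eO_supp K hr hv hall subset_rfl hz, ?_⟩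
    have := bdry_eO K v z
    rwa [hbz, map_zero, add_zero] at this
  · push Not at hall
    obtain ⟨u, huW, ⟨-, huv⟩, hru⟩ := hall
    obtain ⟨n, rfl⟩ : ∃ k, n = k + 1 := ⟨n - 1, by omega⟩
    set N := W.filter (fun w => w ≠ v ∧ r v w) with hNdef
    have hNW : N ⊆ W := Finset.filter_subset _ _
    have hNv : N ⊆ W.erase v := by
      intro w hw
      rw [hNdef, Finset.mem_filter] at hw
      exact Finset.mem_erase.2 ⟨hw.2.1, hw.1⟩
    have hNu : N ⊆ (W.erase v).erase u := by
      intro w hw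
      refine Finset.mem_erase.2 ⟨?_, hNv hw⟩
      rintro rfl
      rw [hNdef, Finset.mem_filter] at hw
      exact hru hw.2.2
    have hNr : ∀ w ∈ N, w ∈ W ∧ w ≠ v → r v w := by
      intro w hw _
      rw [hNdef, Finset.mem_filter] at hw
      exact hw.2.2
    have hc1 : (W.erase v).card + 1 = W.card := Finset.card_erase_add_one hv
    have hc2 : ((W.erase v).erase u).card + 1 = (W.erase v).card :=
      Finset.card_erase_add_one (Finset.mem_erase.2 ⟨huv, huW⟩)
    have hc3 := Finset.card_le_card hNu
    have ha : iO K v z ∈ Finsupp.supported K K (cl r N n) := by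
      refine map_supp K _ (fun s hs => ?_) hz
      rw [iO_single]
      split_ifs with h
      · refine Finsupp.single_mem_supported K _ ⟨?_, ?_, ?_⟩
        · intro w hw
          obtain ⟨hw1, hw2⟩ := Finset.mem_erase.1 hw
          exact Finset.mem_filter.2 ⟨hs.1 hw2, hw1, hs.2.2 v h w hw2 hw1.symm⟩
        · rw [Finset.card_erase_of_mem h, hs.2.1]; rfl
        · intro a ha b hb
          exact hs.2.2 a (Finset.mem_of_mem_erase ha) b (Finset.mem_of_mem_erase hb)
      · exact zero_mem _
    have hba : bdry K (iO K v z) = 0 := by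
      have := bdry_iO K v z
      rwa [hbz, map_zero, add_zero] at this
    obtain ⟨c, hc, hbc⟩ := ih N.card (by omega) N n _ rfl (by omega) ha hba
    have hbec : bdry K (eO K v c) = c - eO K v (iO K v z) := by
      have := bdry_eO K v c
      rw [hbc] at this
      exact eq_sub_of_add_eq this
    have hbei : bdry K (eO K v (iO K v z)) = iO K v z := by
      have := bdry_eO K v (iO K v z)
      rwa [hba, map_zero, add_zero] at this
    have hz' : z + bdry K (eO K v c) ∈ Finsupp.supported K K (cl r (W.erase v) (n + 1)) := by
      have : z + bdry K (eO K v c) = (LinearMap.id - eO K v ∘ₗ iO K v : (Finset ℕ →₀ K) →ₗ[K] (Finset ℕ →₀ K)) z + c := by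
        rw [hbec]
        simp only [LinearMap.sub_apply, LinearMap.id_apply, LinearMap.comp_apply]
        abel
      rw [this]
      refine add_mem ?_ (Finsupp.supported_mono (cl_mono r hNv _) hc)
      refine map_supp K _ (fun s hs => ?_) hz
      simp only [LinearMap.sub_apply, LinearMap.id_apply, LinearMap.comp_apply]
      rw [ei_eq]
      split_ifs with h
      · rw [sub_self]; exact zero_mem _
      · rw [sub_zero]
        exact Finsupp.single_mem_supported K _
          ⟨Finset.subset_erase.2 ⟨hs.1, h⟩, hs.2⟩
    have hbz' : bdry K (z + bdry K (eO K v c)) = 0 := by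
      rw [map_add, hbz, hbec, map_sub, hbc, hbei]; simp
    obtain ⟨c', hc', hbc'⟩ := ih (W.erase v).card (by omega) _ (n + 1) _ rfl (by omega) hz' hbz'
    refine ⟨c' - eO K v c, sub_mem (Finsupp.supported_mono
      (cl_mono r (Finset.erase_subset _ _) _) hc') (eO_supp K hr hv hNr hNW hc), ?_⟩
    rw [map_sub, hbc']; abel

lemma clique_face (Δ : SC) (hC : IsComplex Δ) (hflag : IsFlag Δ) (s : Finset ℕ)
    (hs : s ⊆ vertexSet Δ) (hcl : ∀ u ∈ s, ∀ w ∈ s, u ≠ w → ({u, w} : Finset ℕ) ∈ Δ) : s ∈ Δ := by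
  induction s using Finset.strongInduction with
  | _ s ih =>
  by_contra hn
  have hmin : IsMinNonFace Δ s := ⟨hs, hn, fun M hM => ih M hM (hM.1.trans hs)
    fun u hu w hw => hcl u (hM.1 hu) w (hM.1 hw)⟩
  obtain ⟨u, w, huw, rfl⟩ := Finset.card_eq_two.1 (hflag s hmin)
  exact hn (hcl u (by simp) w (by simp) huw)

end FlagAux

/-- A `j`-cycle of a `(d-1)`-dimensional flag complex which is not a
boundary is supported on simplices whose union of vertex sets has at least `2(j+1)`
elements. -/
theorem statement_5 (K : Type*) [Field K] (d : ℕ) (Δ : SC) (hC : IsComplex Δ)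
    (hdim : Δ.sup Finset.card = d) (hflag : IsFlag Δ) (j : ℕ) (z : Finset ℕ →₀ K)
    (hz : z ∈ cyclesOn K Δ ((j : ℤ) + 1)) (hnb : z ∉ boundariesOn K Δ ((j : ℤ) + 1)) :
    2 * (j + 1) ≤ (z.support.biUnion id).card := by
  by_contra hlt
  push Not at hlt
  apply hnb
  obtain ⟨hz1, hz2⟩ := Submodule.mem_inf.1 hz
  rw [LinearMap.mem_ker] at hz2
  unfold facesSpan at hz1
  rw [← Finsupp.supported_eq_span_single, Finsupp.mem_supported] at hz1
  have hWV : z.support.biUnion id ⊆ vertexSet Δ := by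
    intro x hx
    obtain ⟨t, ht, hxt⟩ := Finset.mem_biUnion.1 hx
    exact Finset.mem_sup.2 ⟨t, (hz1 ht).1, hxt⟩
  obtain ⟨c, hc, hbc⟩ := FlagAux.fill K (fun u w => ({u, w} : Finset ℕ) ∈ Δ)
    (fun u w h => by rwa [Finset.pair_comm]) _ (z.support.biUnion id) (j + 1) z rfl hlt
    (by
      rw [Finsupp.mem_supported]
      intro s hs
      obtain ⟨h1, h2⟩ := hz1 hs
      refine ⟨Finset.subset_biUnion_of_mem id hs, by exact_mod_cast h2, ?_⟩
      intro u hu w hw _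
      refine hC s h1 _ ?_
      intro x hx
      rcases Finset.mem_insert.1 hx with rfl | hx
      · exact hu
      · rw [Finset.mem_singleton.1 hx]; exact hw) hz2
  refine Submodule.mem_map.2 ⟨c, ?_, hbc⟩
  unfold facesSpan
  rw [← Finsupp.supported_eq_span_single]
  refine Finsupp.supported_mono ?_ hc
  intro s hs
  refine ⟨FlagAux.clique_face Δ hC hflag s (hs.1.trans hWV) hs.2.2, ?_⟩
  rw [hs.2.1]; push_cast; ring
end

section
/- Let d ≥ 1, let r ≥ 2 and 1 ≤ j ≤ d-2 be integers, and let (i_1,…,i_r) ∈ ℕ^r satisfy (i) i_1+⋯+i_r+(r-1) = j-1 and (ii) i_1+⋯+i_r+2r ≤ d. Then β_{i,i+j}(K[sd(Δ_{d-1})]) ≠ 0 for every integer i with Σ_{ℓ=1}^r (2^{i_ℓ+2} - 2) - j ≤ i ≤ Σ_{ℓ=1}^r (2^{i_ℓ+2} - 2) + (2^{i_r+2} - 2)·2^{i_2+⋯+i_{r-1}+2r-4} - j. -/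
open Finset BigOperators

section ExtPart
open ExteriorAlgebra

variable (K : Type*) [Field K]

/-- The exterior algebra on the free module with basis `ℕ`. -/
abbrev EA := ExteriorAlgebra K (ℕ →₀ K)

/-- Generators. -/
noncomputable def eg (v : ℕ) : EA K := ExteriorAlgebra.ι K (Finsupp.single v (1 : K))

/-- Wedge of a list. -/
noncomputable def wl (l : List ℕ) : EA K := (l.map (eg K)).prod

/-- Augmentation. -/
noncomputable def epsA : Module.Dual K (ℕ →₀ K) := Finsupp.lsum K fun _ => LinearMap.id

/-- Contraction with the augmentation. -/
noncomputable def DD : EA K →ₗ[K] EA K :=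
  CliffordAlgebra.contractLeft (Q := (0 : QuadraticForm K (ℕ →₀ K))) (epsA K)

theorem wl_nil : wl K [] = 1 := by simp [wl]

theorem wl_cons (a : ℕ) (l : List ℕ) : wl K (a :: l) = eg K a * wl K l := by simp [wl]

theorem wl_append (l l' : List ℕ) : wl K (l ++ l') = wl K l * wl K l' := by simp [wl]

theorem DD_one : DD K 1 = 0 := CliffordAlgebra.contractLeft_one _ _

theorem DD_ι_mul (m : ℕ →₀ K) (x : EA K) :
    DD K (ExteriorAlgebra.ι K m * x) = epsA K m • x - ExteriorAlgebra.ι K m * DD K x :=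
  CliffordAlgebra.contractLeft_ι_mul _ _ _

theorem DD_eg_mul (v : ℕ) (x : EA K) : DD K (eg K v * x) = x - eg K v * DD K x := by
  unfold eg
  rw [DD_ι_mul]
  simp [epsA]

theorem eg_sq (a : ℕ) : eg K a * eg K a = 0 := ExteriorAlgebra.ι_sq_zero _

theorem eg_swap (a b : ℕ) : eg K a * eg K b = - (eg K b * eg K a) :=
  eq_neg_of_add_eq_zero_left (ExteriorAlgebra.ι_add_mul_swap _ _)

theorem wl_perm {l l' : List ℕ} (h : l.Perm l') :
    ∃ u : K, (u = 1 ∨ u = -1) ∧ wl K l = u • wl K l' := by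
  induction h with
  | nil => exact ⟨1, Or.inl rfl, by simp⟩
  | cons x _ ih =>
    obtain ⟨u, hu, h⟩ := ih
    exact ⟨u, hu, by rw [wl_cons, wl_cons, h, mul_smul_comm]⟩
  | swap x y l =>
    refine ⟨-1, Or.inr rfl, ?_⟩
    simp only [wl_cons]
    rw [← mul_assoc, eg_swap, ← mul_assoc]
    simp
  | trans _ _ ih1 ih2 =>
    obtain ⟨u, hu, h⟩ := ih1
    obtain ⟨v, hv, h'⟩ := ih2
    refine ⟨u * v, ?_, by rw [h, h', mul_smul]⟩
    rcases hu with rfl | rfl <;> rcases hv with rfl | rfl <;> simp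

theorem wl_not_nodup {l : List ℕ} (h : ¬ l.Nodup) : wl K l = 0 := by
  obtain ⟨a, ha⟩ : ∃ a, List.Duplicate a l := by
    by_contra hc
    push Not at hc
    exact h (List.nodup_iff_forall_not_duplicate.2 hc)
  have h2 : List.Sublist [a, a] l := List.duplicate_iff_sublist.1 ha
  obtain ⟨m, hm⟩ := h2.exists_perm_append
  obtain ⟨u, _, hu⟩ := wl_perm K hm
  rw [hu]
  simp only [List.cons_append, List.nil_append, wl_cons]
  rw [← mul_assoc, eg_sq, zero_mul, smul_zero]

/-- The basis of the exterior algebra. -/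
noncomputable def bE : Module.Basis (Finset ℕ) K (EA K) :=
  Module.Basis.ExteriorAlgebra (Finsupp.basisSingleOne (R := K) (ι := ℕ))

theorem bE_apply (s : Finset ℕ) : bE K s = wl K (s.sort (· ≤ ·)) := by
  unfold bE
  rw [ExteriorAlgebra.basis_apply]
  unfold ExteriorAlgebra.ιMulti_family
  rw [ExteriorAlgebra.ιMulti_apply]
  unfold wl
  congr 1
  apply List.ext_getElem
  · simp
  · intro n h1 h2
    simp only [List.getElem_ofFn, List.getElem_map, eg, Function.comp_apply,
      Finsupp.coe_basisSingleOne]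
    rfl

theorem eg_mul_bE (a : ℕ) (s : Finset ℕ) (h : ∀ x ∈ s, a < x) :
    eg K a * bE K s = bE K (insert a s) := by
  rw [bE_apply, bE_apply, Finset.sort_insert (r := (· ≤ ·)) (fun b hb => (h b hb).le)
    (fun ha => lt_irrefl _ (h a ha)), wl_cons]

theorem DD_bE (s : Finset ℕ) : DD K (bE K s) =
    ∑ v ∈ s, ((-1 : K) ^ ((s.filter (fun w => w < v)).card)) • bE K (s.erase v) := by
  induction s using Finset.induction_on_min with
  | empty => simp [bE_apply, wl_nil, DD_one]
  | insert a s h ih =>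
    have ha : a ∉ s := fun ha => lt_irrefl _ (h a ha)
    rw [← eg_mul_bE K a s h, DD_eg_mul, ih, Finset.sum_insert ha, sub_eq_add_neg]
    congr 1
    · have : (insert a s).filter (fun w => w < a) = ∅ := by
        ext x
        simp only [Finset.mem_filter, Finset.mem_insert, Finset.notMem_empty, iff_false]
        rintro ⟨rfl | hx, h'⟩
        · exact lt_irrefl _ h'
        · exact lt_asymm h' (h x hx)
      rw [this, Finset.erase_insert ha]
      simp
    · rw [Finset.mul_sum, ← Finset.sum_neg_distrib]
      refine Finset.sum_congr rfl fun v hv => ?_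
      have hav := h v hv
      rw [Finset.filter_insert, if_pos hav, Finset.card_insert_of_notMem (by simp [ha]),
        Finset.erase_insert_of_ne hav.ne, mul_smul_comm,
        eg_mul_bE K a (s.erase v) (fun x hx => h x (Finset.mem_of_mem_erase hx)), pow_succ]
      simp

theorem repr_DD (x : EA K) : (bE K).repr (DD K x) = bdry K ((bE K).repr x) := by
  have : ((bE K).repr.toLinearMap ∘ₗ DD K) = bdry K ∘ₗ (bE K).repr.toLinearMap := by
    refine (bE K).ext fun s => ?_
    simp only [LinearMap.comp_apply, LinearEquiv.coe_coe]
    rw [DD_bE, (bE K).repr_self]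
    simp [bdry, bdryFace]
  exact LinearMap.congr_fun this x

theorem repr_wl {l : List ℕ} (h : l.Nodup) :
    ∃ u : K, (u = 1 ∨ u = -1) ∧ (bE K).repr (wl K l) = Finsupp.single l.toFinset u := by
  have hp : l.Perm (l.toFinset.sort (· ≤ ·)) := by
    apply List.perm_of_nodup_nodup_toFinset_eq h (Finset.sort_nodup _ _)
    simp
  obtain ⟨u, hu, hw⟩ := wl_perm K hp
  refine ⟨u, hu, ?_⟩
  rw [hw, ← bE_apply, map_smul, (bE K).repr_self]
  simp

/-- Pushforward along a vertex map. -/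
noncomputable def fE (f : ℕ → ℕ) : EA K →ₐ[K] EA K := ExteriorAlgebra.map (Finsupp.lmapDomain K K f)

theorem fE_eg (f : ℕ → ℕ) (v : ℕ) : fE K f (eg K v) = eg K (f v) := by
  unfold fE eg
  rw [ExteriorAlgebra.map_apply_ι]
  simp

theorem fE_wl (f : ℕ → ℕ) (l : List ℕ) : fE K f (wl K l) = wl K (l.map f) := by
  induction l with
  | nil => simp [wl_nil]
  | cons a l ih => rw [List.map_cons, wl_cons, wl_cons, map_mul, fE_eg, ih]

theorem fE_DD_wl (f : ℕ → ℕ) (l : List ℕ) : fE K f (DD K (wl K l)) = DD K (wl K (l.map f)) := by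
  induction l with
  | nil => simp [wl_nil, DD_one]
  | cons a l ih => rw [List.map_cons, wl_cons, wl_cons, DD_eg_mul, DD_eg_mul, map_sub, map_mul,
      fE_eg, ih, fE_wl]

theorem fE_DD (f : ℕ → ℕ) (x : EA K) : fE K f (DD K x) = DD K (fE K f x) := by
  have : ((fE K f).toLinearMap ∘ₗ DD K) = DD K ∘ₗ (fE K f).toLinearMap := by
    refine (bE K).ext fun s => ?_
    simp only [LinearMap.comp_apply, AlgHom.toLinearMap_apply]
    rw [bE_apply, fE_DD_wl, fE_wl]
  exact LinearMap.congr_fun this x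

/-- Abstract criterion for a signed sum of wedges to be a cycle. -/
theorem DD_sum_aux {G : Type*} [DecidableEq G] (S : Finset G) (c : G → K) (h : G → ℕ → ℕ)
    (L P : List ℕ) (hn : (P ++ L).Nodup)
    (hτ : ∀ k ∈ P ++ L, ∃ τ : G → G, (∀ g ∈ S, τ g ∈ S ∧ τ (τ g) = g ∧ τ g ≠ g ∧ c (τ g) = - c g ∧
      ∀ k' ∈ P ++ L, k' ≠ k → h (τ g) k' = h g k')) :
    ∑ g ∈ S, c g • (wl K (P.map (h g)) * DD K (wl K (L.map (h g)))) = 0 := by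
  induction L generalizing P with
  | nil => simp [wl_nil, DD_one]
  | cons k L ih =>
    have e : ∀ g, c g • (wl K (P.map (h g)) * DD K (wl K ((k :: L).map (h g)))) =
        c g • wl K ((P ++ L).map (h g)) -
        c g • (wl K ((P ++ [k]).map (h g)) * DD K (wl K (L.map (h g)))) := by
      intro g
      rw [List.map_cons, wl_cons, DD_eg_mul, List.map_append, wl_append, List.map_append,
        wl_append, mul_sub, smul_sub]
      simp [wl_cons, wl_nil, mul_assoc]
    rw [Finset.sum_congr rfl fun g _ => e g, Finset.sum_sub_distrib]
    have hn' : (P ++ [k] ++ L) = P ++ k :: L := by simp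
    rw [ih (P ++ [k]) (by rw [hn']; exact hn) (by rw [hn']; exact hτ), sub_zero]
    obtain ⟨τ, hτ'⟩ := hτ k (by simp)
    refine Finset.sum_involution (fun g _ => τ g) (fun g hg => ?_) (fun g hg _ => (hτ' g hg).2.2.1)
      (fun g hg => (hτ' g hg).1) (fun g hg => (hτ' g hg).2.1)
    obtain ⟨_, _, _, h4, h5⟩ := hτ' g hg
    have : (P ++ L).map (h (τ g)) = (P ++ L).map (h g) := by
      refine List.map_congr_left fun k' hk' => h5 k' ?_ ?_
      · simp only [List.mem_append, List.mem_cons] at hk' ⊢; tauto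
      · rintro rfl
        have := (List.nodup_middle.1 hn)
        exact (List.nodup_cons.1 this).1 hk'
    rw [this, h4]
    simp

end ExtPart
section CritPart
variable (K : Type*) [Field K]

theorem redH_ne (Δ : SC) (j : ℕ) (Z : EA K) (hZ : (bE K).repr Z ∈ facesSpan K Δ (j : ℤ))
    (hD : DD K Z = 0) (h0 : Z ≠ 0) (f : ℕ → ℕ) (hfZ : fE K f Z = Z)
    (hf : ∀ t ∈ Δ, t.card = j + 1 → ¬ Set.InjOn f (t : Set ℕ)) :
    redHdim K Δ (j : ℤ) ≠ 0 := by
  have hcyc : (bE K).repr Z ∈ cyclesOn K Δ (j : ℤ) := by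
    refine ⟨hZ, ?_⟩
    rw [SetLike.mem_coe, LinearMap.mem_ker, ← repr_DD, hD, map_zero]
  have hker : ∀ c ∈ facesSpan K Δ ((j : ℤ) + 1), fE K f ((bE K).repr.symm c) = 0 := by
    intro c hc
    induction hc using Submodule.span_induction with
    | mem x hx =>
      obtain ⟨t, ⟨ht, htc⟩, rfl⟩ := hx
      simp only [Module.Basis.repr_symm_single_one]
      rw [bE_apply, fE_wl]
      apply wl_not_nodup
      intro hn
      refine hf t ht (by exact_mod_cast htc) ?_
      intro a ha b hb hab
      exact List.inj_on_of_nodup_map hn (by simpa using ha) (by simpa using hb) hab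
    | zero => simp
    | add x y _ _ hx hy => rw [map_add, map_add, hx, hy, add_zero]
    | smul a x _ hx => rw [map_smul, map_smul, hx, smul_zero]
  have hnb : (bE K).repr Z ∉ boundariesOn K Δ (j : ℤ) := by
    rintro ⟨c, hc, hcz⟩
    apply h0
    have h1 : DD K ((bE K).repr.symm c) = Z := by
      apply (bE K).repr.injective
      rw [repr_DD, LinearEquiv.apply_symm_apply, hcz]
    rw [← hfZ, ← h1, fE_DD, hker c hc, map_zero]
  have hfin : FiniteDimensional K ↥(facesSpan K Δ (j : ℤ)) := by
    apply FiniteDimensional.span_of_finite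
    apply Set.Finite.image
    exact Δ.finite_toSet.subset fun s hs => hs.1
  have hfin2 : FiniteDimensional K ↥(cyclesOn K Δ (j : ℤ)) :=
    Submodule.finiteDimensional_of_le (inf_le_left : cyclesOn K Δ (j : ℤ) ≤ facesSpan K Δ (j : ℤ))
  have hlt : boundariesOn K Δ (j : ℤ) ⊓ cyclesOn K Δ (j : ℤ) < cyclesOn K Δ (j : ℤ) :=
    lt_of_le_of_ne inf_le_right fun h => hnb (by rw [← h] at hcyc; exact hcyc.1)
  have := Submodule.finrank_lt_finrank_of_lt hlt
  unfold redHdim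
  omega

end CritPart

section CombPart

theorem enc_inj : Function.Injective enc := fun _ _ h => Encodable.encode_injective h

/-- Left inverse of `enc`. -/
def dec (v : ℕ) : Finset ℕ := ((Encodable.decode v : Option (Finset ℕ))).getD ∅

theorem dec_enc (X : Finset ℕ) : dec (enc X) = X := by
  simp [dec, enc, Encodable.encodek]

/-- The vertices of the join of spheres. -/
def W0 (s : ℕ → ℕ) (r : ℕ) : Finset (Finset ℕ) :=
  (Finset.range r).biUnion fun l => Finset.Ioo (Finset.range (s l)) (Finset.range (s (l + 1)))

/-- The additional vertices. -/
def Wn (s : ℕ → ℕ) (r : ℕ) : Finset (Finset ℕ) :=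
  ((Finset.Ico (s 1) (s (r - 1))).powerset ×ˢ
    Finset.Ioo ∅ (Finset.Ico (s (r - 1)) (s r))).image fun p => p.1 ∪ p.2

/-- The ranks. -/
def Lset (s : ℕ → ℕ) (r : ℕ) : Finset ℕ :=
  Finset.range (s r) \ (Finset.range r).image s

theorem mem_W0 {s : ℕ → ℕ} {r : ℕ} {X : Finset ℕ} : X ∈ W0 s r ↔
    ∃ l < r, Finset.range (s l) ⊂ X ∧ X ⊂ Finset.range (s (l + 1)) := by
  simp [W0]

theorem card_Lset {s : ℕ → ℕ} (hs : StrictMono s) (r : ℕ) : (Lset s r).card = s r - r := by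
  unfold Lset
  rw [Finset.card_sdiff_of_subset, Finset.card_image_of_injective _ hs.injective]
  · simp
  · intro x hx
    simp only [Finset.mem_image, Finset.mem_range] at hx ⊢
    obtain ⟨l, hl, rfl⟩ := hx
    exact hs hl

theorem mem_Lset {s : ℕ → ℕ} (hs : StrictMono s) {r k : ℕ} : k ∈ Lset s r ↔
    k < s r ∧ ∀ l, k ≠ s l := by
  unfold Lset
  simp only [Finset.mem_sdiff, Finset.mem_range, Finset.mem_image, not_exists, not_and]
  refine ⟨fun ⟨h1, h2⟩ => ⟨h1, fun l hl => ?_⟩, fun ⟨h1, h2⟩ => ⟨h1, fun l _ h => h2 l h.symm⟩⟩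
  subst hl
  exact h2 l (hs.lt_iff_lt.1 h1) rfl

theorem card_mem_Lset {s : ℕ → ℕ} (hs : StrictMono s) {r : ℕ} {X : Finset ℕ} (hX : X ∈ W0 s r) :
    X.card ∈ Lset s r := by
  obtain ⟨l, hl, h1, h2⟩ := mem_W0.1 hX
  have h1' := Finset.card_lt_card h1
  have h2' := Finset.card_lt_card h2
  simp only [Finset.card_range] at h1' h2'
  refine (mem_Lset hs).2 ⟨h2'.trans_le (hs.monotone hl), fun m hm => ?_⟩
  rw [hm] at h1' h2'
  have := hs.lt_iff_lt.1 h1'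
  have := hs.lt_iff_lt.1 h2'
  omega

theorem exists_block {s : ℕ → ℕ} (hs0 : s 0 = 0) {r k : ℕ} (h1 : k < s r) (h2 : ∀ l, k ≠ s l) :
    ∃ l < r, s l < k ∧ k < s (l + 1) := by
  induction r with
  | zero => omega
  | succ r ih =>
    by_cases h : k < s r
    · obtain ⟨l, hl, h⟩ := ih h
      exact ⟨l, by omega, h⟩
    · have := h2 r
      exact ⟨r, by omega, by omega, h1⟩

theorem card_W0 {s : ℕ → ℕ} (hs : StrictMono s) (r : ℕ) :
    (W0 s r).card = ∑ l ∈ Finset.range r, (2 ^ (s (l + 1) - s l) - 2) := by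
  unfold W0
  rw [Finset.card_biUnion]
  · refine Finset.sum_congr rfl fun l _ => ?_
    rw [Finset.card_Ioo_finset]
    · simp
    · exact Finset.range_subset_range.2 (hs.monotone (Nat.le_succ l))
  · have key : ∀ l m, l < m → Disjoint (Finset.Ioo (Finset.range (s l)) (Finset.range (s (l + 1))))
        (Finset.Ioo (Finset.range (s m)) (Finset.range (s (m + 1)))) := by
      intro l m hlm
      rw [Finset.disjoint_left]
      intro X h1 h2
      rw [Finset.mem_Ioo] at h1 h2
      have h3 := Finset.card_lt_card h1.2
      have h4 := Finset.card_lt_card h2.1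
      simp only [Finset.card_range] at h3 h4
      have := hs.monotone (show l + 1 ≤ m from hlm)
      omega
    intro l _ m _ hlm
    rcases lt_or_gt_of_ne hlm with h | h
    · exact key _ _ h
    · exact (key _ _ h).symm

theorem card_Wn (s : ℕ → ℕ) (r : ℕ) :
    (Wn s r).card = 2 ^ (s (r - 1) - s 1) * (2 ^ (s r - s (r - 1)) - 2) := by
  unfold Wn
  rw [Finset.card_image_of_injOn, Finset.card_product, Finset.card_powerset,
    Finset.card_Ioo_finset (Finset.empty_subset _)]
  · simp
  · rintro ⟨a, b⟩ h ⟨a', b'⟩ h' e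
    simp only [Finset.coe_product, Set.mem_prod, Finset.mem_coe, Finset.mem_powerset,
      Finset.mem_Ioo] at h h'
    have ha := h.1
    have ha' := h'.1
    have hb := h.2.2.subset
    have hb' := h'.2.2.subset
    simp only at e
    have e' : ∀ x, x ∈ a ∪ b ↔ x ∈ a' ∪ b' := fun x => by rw [e]
    simp only [Finset.mem_union] at e'
    have a1 : ∀ x ∈ a, x < s (r - 1) := fun x hx => (Finset.mem_Ico.1 (ha hx)).2
    have a2 : ∀ x ∈ a', x < s (r - 1) := fun x hx => (Finset.mem_Ico.1 (ha' hx)).2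
    have b1 : ∀ x ∈ b, s (r - 1) ≤ x := fun x hx => (Finset.mem_Ico.1 (hb hx)).1
    have b2 : ∀ x ∈ b', s (r - 1) ≤ x := fun x hx => (Finset.mem_Ico.1 (hb' hx)).1
    ext x
    · have := e' x; have := a1 x; have := a2 x; have := b1 x; have := b2 x
      grind
    · have := e' x; have := a1 x; have := a2 x; have := b1 x; have := b2 x
      grind

theorem W0_meets {s : ℕ → ℕ} (hs : StrictMono s) (hs0 : s 0 = 0) {r : ℕ} {X : Finset ℕ}
    (hX : X ∈ W0 s r) : ∃ x ∈ X, x < s 1 := by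
  obtain ⟨l, hl, h1, h2⟩ := mem_W0.1 hX
  rcases Nat.eq_zero_or_pos l with rfl | h
  · rw [hs0, Finset.range_zero, Finset.empty_ssubset] at h1
    obtain ⟨x, hx⟩ := h1
    exact ⟨x, hx, by simpa using h2.subset hx⟩
  · refine ⟨0, h1.subset ?_, ?_⟩
    · rw [Finset.mem_range, ← hs0]; exact hs h
    · rw [← hs0]; exact hs Nat.one_pos

theorem W0_lt {s : ℕ → ℕ} (hs : StrictMono s) {r : ℕ} {X : Finset ℕ}
    (hX : X ∈ W0 s r) : ∀ x ∈ X, x < s r := by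
  obtain ⟨l, hl, h1, h2⟩ := mem_W0.1 hX
  intro x hx
  exact (Finset.mem_range.1 (h2.subset hx)).trans_le (hs.monotone hl)

theorem mem_Wn {s : ℕ → ℕ} {r : ℕ} {X : Finset ℕ} (hX : X ∈ Wn s r) :
    ∃ M A, M ⊆ Finset.Ico (s 1) (s (r - 1)) ∧ A.Nonempty ∧ A ⊂ Finset.Ico (s (r - 1)) (s r) ∧
      X = M ∪ A := by
  simp only [Wn, Finset.mem_image, Finset.mem_product, Finset.mem_powerset, Finset.mem_Ioo] at hX
  obtain ⟨⟨M, A⟩, ⟨h1, h2, h3⟩, h4⟩ := hX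
  exact ⟨M, A, h1, Finset.empty_ssubset.1 h2, h3, h4.symm⟩

theorem Wn_ge {s : ℕ → ℕ} (hs : StrictMono s) {r : ℕ} (hr : 2 ≤ r) {X : Finset ℕ}
    (hX : X ∈ Wn s r) : ∀ x ∈ X, s 1 ≤ x ∧ x < s r := by
  obtain ⟨M, A, h1, h2, h3, rfl⟩ := mem_Wn hX
  intro x hx
  have := hs.monotone (show 1 ≤ r - 1 by omega)
  have := hs.monotone (show r - 1 ≤ r by omega)
  rcases Finset.mem_union.1 hx with h | h
  · have := Finset.mem_Ico.1 (h1 h); omega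
  · have := Finset.mem_Ico.1 (h3.subset h); omega

/-- The retraction. -/
def ret (s : ℕ → ℕ) (r : ℕ) (X : Finset ℕ) : Finset ℕ :=
  if ∃ x ∈ X, x < s 1 then X else X ∪ Finset.range (s (r - 1))

theorem ret_W0 {s : ℕ → ℕ} (hs : StrictMono s) (hs0 : s 0 = 0) {r : ℕ} {X : Finset ℕ}
    (hX : X ∈ W0 s r) : ret s r X = X := if_pos (W0_meets hs hs0 hX)

theorem ret_Wn {s : ℕ → ℕ} (hs : StrictMono s) {r : ℕ} (hr : 2 ≤ r) {X : Finset ℕ}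
    (hX : X ∈ Wn s r) : ret s r X = X ∪ Finset.range (s (r - 1)) := by
  apply if_neg
  rintro ⟨x, hx, h⟩
  have := Wn_ge hs hr hX x hx
  omega

theorem ret_mem {s : ℕ → ℕ} (hs : StrictMono s) (hs0 : s 0 = 0) {r : ℕ} (hr : 2 ≤ r)
    {X : Finset ℕ} (hX : X ∈ W0 s r ∪ Wn s r) : ret s r X ∈ W0 s r := by
  rcases Finset.mem_union.1 hX with h | h
  · rwa [ret_W0 hs hs0 h]
  · rw [ret_Wn hs hr h]
    obtain ⟨M, A, h1, ⟨a, ha⟩, h3, rfl⟩ := mem_Wn h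
    have hlt := hs (show r - 1 < r by omega)
    obtain ⟨b, hb, hbA⟩ := Finset.exists_of_ssubset h3
    refine mem_W0.2 ⟨r - 1, by omega, ?_, ?_⟩
    · refine Finset.ssubset_iff_subset_ne.2 ⟨Finset.subset_union_right, fun he => ?_⟩
      have h5 : a ∈ Finset.range (s (r - 1)) := by rw [he]; simp [ha]
      have h6 := Finset.mem_Ico.1 (h3.subset ha)
      have := Finset.mem_range.1 h5
      omega
    · rw [show r - 1 + 1 = r by omega]
      refine (Finset.ssubset_iff_of_subset ?_).2 ⟨b, ?_, ?_⟩
      · intro x hx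
        rcases Finset.mem_union.1 hx with hx | hx
        · exact Finset.mem_range.2 (Wn_ge hs hr h x hx).2
        · have := Finset.mem_range.1 hx
          rw [Finset.mem_range]; omega
      · have := Finset.mem_Ico.1 hb
        rw [Finset.mem_range]; omega
      · have hb' := Finset.mem_Ico.1 hb
        simp only [Finset.mem_union, Finset.mem_range, not_or]
        refine ⟨⟨fun hm => ?_, hbA⟩, by omega⟩
        have := Finset.mem_Ico.1 (h1 hm)
        omega

theorem ret_mono {s : ℕ → ℕ} (hs : StrictMono s) (hs0 : s 0 = 0) {r : ℕ} (hr : 2 ≤ r)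
    {X Y : Finset ℕ} (hX : X ∈ W0 s r ∪ Wn s r) (hY : Y ∈ W0 s r ∪ Wn s r) (hXY : X ⊆ Y) :
    ret s r X ⊆ ret s r Y := by
  rcases Finset.mem_union.1 hX with hX | hX <;> rcases Finset.mem_union.1 hY with hY | hY
  · rwa [ret_W0 hs hs0 hX, ret_W0 hs hs0 hY]
  · exfalso
    obtain ⟨x, hx, hlt⟩ := W0_meets hs hs0 hX
    have := Wn_ge hs hr hY x (hXY hx)
    omega
  · rw [ret_Wn hs hr hX, ret_W0 hs hs0 hY]
    refine Finset.union_subset hXY ?_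
    obtain ⟨M, A, h1, ⟨a, ha⟩, h3, rfl⟩ := mem_Wn hX
    obtain ⟨l, hl, h4, h5⟩ := mem_W0.1 hY
    have h6 := Finset.mem_range.1 (h5.subset (hXY (Finset.mem_union_right _ ha)))
    have h7 := Finset.mem_Ico.1 (h3.subset ha)
    have h8 : r - 1 < l + 1 := hs.lt_iff_lt.1 (by omega)
    exact (Finset.range_subset_range.2 (hs.monotone (by omega))).trans h4.subset
  · rw [ret_Wn hs hr hX, ret_Wn hs hr hY]
    exact Finset.union_subset_union_left hXY

end CombPart
section CyclePart

/-- Image of an initial segment under a permutation. -/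
def hh {n : ℕ} (g : Equiv.Perm (Fin n)) (k : ℕ) : Finset ℕ :=
  (Finset.univ.filter (fun x : Fin n => x.val < k)).image (fun x => (g x).val)

theorem mem_hh {n : ℕ} {g : Equiv.Perm (Fin n)} {k y : ℕ} :
    y ∈ hh g k ↔ ∃ x : Fin n, x.val < k ∧ (g x).val = y := by
  simp [hh]

theorem mem_hh' {n : ℕ} {g : Equiv.Perm (Fin n)} {k : ℕ} {x : Fin n} :
    (g x).val ∈ hh g k ↔ x.val < k := by
  rw [mem_hh]
  refine ⟨fun ⟨x', h, h'⟩ => ?_, fun h => ⟨x, h, rfl⟩⟩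
  rwa [← g.injective (Fin.ext h')]

theorem card_hh {n : ℕ} (g : Equiv.Perm (Fin n)) {k : ℕ} (hk : k ≤ n) : (hh g k).card = k := by
  unfold hh
  rw [Finset.card_image_of_injective _ (fun a b h => g.injective (Fin.ext h))]
  rw [Fin.card_filter_val_lt]
  omega

theorem hh_mono {n : ℕ} (g : Equiv.Perm (Fin n)) {k k' : ℕ} (h : k ≤ k') : hh g k ⊆ hh g k' := by
  intro y hy
  obtain ⟨x, hx, h'⟩ := mem_hh.1 hy
  exact mem_hh.2 ⟨x, by omega, h'⟩

open scoped Classical in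
/-- The block-preserving permutations. -/
noncomputable def GG (s : ℕ → ℕ) (n : ℕ) : Finset (Equiv.Perm (Fin n)) :=
  Finset.univ.filter fun g => ∀ l, ∀ x : Fin n, (g x).val < s l ↔ x.val < s l

theorem mem_GG {s : ℕ → ℕ} {n : ℕ} {g : Equiv.Perm (Fin n)} :
    g ∈ GG s n ↔ ∀ l, ∀ x : Fin n, (g x).val < s l ↔ x.val < s l := by
  simp [GG]

theorem hh_block {s : ℕ → ℕ} {n : ℕ} {g : Equiv.Perm (Fin n)} (hg : g ∈ GG s n) {l : ℕ}
    (hl : s l ≤ n) : hh g (s l) = Finset.range (s l) := by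
  apply Finset.eq_of_subset_of_card_le
  · intro y hy
    obtain ⟨x, hx, rfl⟩ := mem_hh.1 hy
    exact Finset.mem_range.2 ((mem_GG.1 hg l x).2 hx)
  · rw [card_hh g hl, Finset.card_range]

theorem hh_mem_W0 {s : ℕ → ℕ} (hs : StrictMono s) (hs0 : s 0 = 0) {r : ℕ}
    {g : Equiv.Perm (Fin (s r))} (hg : g ∈ GG s (s r)) {k : ℕ} (hk : k ∈ Lset s r) :
    hh g k ∈ W0 s r := by
  obtain ⟨h1, h2⟩ := (mem_Lset hs).1 hk
  obtain ⟨l, hl, h3, h4⟩ := exists_block hs0 h1 h2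
  have h5 : s (l + 1) ≤ s r := hs.monotone hl
  have h6 : s l ≤ s r := hs.monotone hl.le
  refine mem_W0.2 ⟨l, hl, ?_, ?_⟩
  · rw [← hh_block hg h6]
    refine Finset.ssubset_iff_subset_ne.2 ⟨hh_mono g h3.le, fun he => ?_⟩
    have := congrArg Finset.card he
    rw [card_hh g h6, card_hh g h1.le] at this
    omega
  · rw [← hh_block hg h5]
    refine Finset.ssubset_iff_subset_ne.2 ⟨hh_mono g h4.le, fun he => ?_⟩
    have := congrArg Finset.card he
    rw [card_hh g h5, card_hh g h1.le] at this
    omega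

theorem swap_lt {n k m : ℕ} (hk : k < n) (hm : m ≠ k) (hk0 : k ≠ 0) (x : Fin n) :
    (Equiv.swap (⟨k - 1, by omega⟩ : Fin n) ⟨k, hk⟩ x).val < m ↔ x.val < m := by
  rw [Equiv.swap_apply_def]
  split_ifs with h1 h2
  · subst h1; simp only; omega
  · subst h2; simp only; omega
  · rfl

theorem eq_one_of_hh {s : ℕ → ℕ} (hs : StrictMono s) {r : ℕ}
    {g : Equiv.Perm (Fin (s r))} (hg : g ∈ GG s (s r))
    (h : ∀ k ∈ Lset s r, hh g k = hh (1 : Equiv.Perm (Fin (s r))) k) : g = 1 := by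
  have key : ∀ k, k ≤ s r → ∀ x : Fin (s r), x.val < k → (g x).val < k := by
    intro k hk x hx
    by_cases hL : ∃ l, k = s l
    · obtain ⟨l, rfl⟩ := hL
      exact (mem_GG.1 hg l x).2 hx
    · push Not at hL
      have hk' : k ∈ Lset s r := (mem_Lset hs).2 ⟨lt_of_le_of_ne hk (hL r), hL⟩
      have h1 : (g x).val ∈ hh (1 : Equiv.Perm (Fin (s r))) k := by
        rw [← h k hk']; exact mem_hh'.2 hx
      obtain ⟨y, hy, h2⟩ := mem_hh.1 h1
      rw [← h2]; exact hy
  have le1 : ∀ x : Fin (s r), g x ≤ x := by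
    intro x
    have := key (x.val + 1) x.isLt x (Nat.lt_succ_self _)
    exact Fin.le_def.2 (by omega)
  have : ∀ m, ∀ x : Fin (s r), x.val = m → g x = x := by
    intro m
    induction m using Nat.strong_induction_on with
    | _ m ih =>
      intro x hx
      by_contra hne
      have hlt : (g x).val < m := by
        have := Fin.le_def.1 (le1 x)
        have h3 : (g x).val ≠ x.val := fun h => hne (Fin.ext h)
        omega
      exact hne (g.injective (ih _ hlt (g x) rfl))
  exact Equiv.ext fun x => this _ x rfl

variable (K : Type*) [Field K]

/-- The list of vertices of the facet attached to a permutation. -/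
noncomputable def fl (s : ℕ → ℕ) (r : ℕ) (g : Equiv.Perm (Fin (s r))) : List ℕ :=
  (Lset s r).toList.map fun k => enc (hh g k)

/-- The fundamental cycle. -/
noncomputable def ZZ (s : ℕ → ℕ) (r : ℕ) : EA K :=
  ∑ g ∈ GG s (s r), (((Equiv.Perm.sign g : ℤˣ) : ℤ) : K) • wl K (fl s r g)

theorem DD_ZZ {s : ℕ → ℕ} (hs : StrictMono s) (hs0 : s 0 = 0) (r : ℕ) : DD K (ZZ K s r) = 0 := by
  unfold ZZ
  rw [map_sum]
  have := DD_sum_aux K (GG s (s r)) (fun g => (((Equiv.Perm.sign g : ℤˣ) : ℤ) : K))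
    (fun g k => enc (hh g k)) (Lset s r).toList [] (by simpa using Finset.nodup_toList _) ?_
  · simpa [wl_nil, fl] using this
  · intro k hk
    simp only [List.nil_append, Finset.mem_toList] at hk
    obtain ⟨h1, h2⟩ := (mem_Lset hs).1 hk
    have hk0 : k ≠ 0 := by rw [← hs0]; exact h2 0
    have hne : (⟨k - 1, by omega⟩ : Fin (s r)) ≠ ⟨k, h1⟩ := by
      intro h; have := congrArg Fin.val h; simp only at this; omega
    refine ⟨fun g => g * Equiv.swap (⟨k - 1, by omega⟩ : Fin (s r)) ⟨k, h1⟩,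
      fun g hg => ⟨?_, ?_, ?_, ?_, ?_⟩⟩
    · rw [mem_GG] at hg ⊢
      intro l x
      rw [Equiv.Perm.mul_apply, hg l, swap_lt h1 (h2 l).symm hk0]
    · simp [mul_assoc]
    · intro h
      rw [mul_eq_left] at h
      exact hne (Equiv.swap_eq_one_iff.1 h)
    · simp [Equiv.Perm.sign_swap hne]
    · intro k' _ hkk'
      congr 1
      ext y
      rw [mem_hh, mem_hh]
      constructor
      · rintro ⟨x, hx, hy⟩
        exact ⟨_, (swap_lt h1 hkk' hk0 x).2 hx, hy⟩
      · rintro ⟨x, hx, hy⟩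
        refine ⟨_, (swap_lt h1 hkk' hk0 x).2 hx, ?_⟩
        rw [← hy, Equiv.Perm.mul_apply, Equiv.swap_apply_self]

theorem fl_nodup {s : ℕ → ℕ} (hs : StrictMono s) {r : ℕ} (g : Equiv.Perm (Fin (s r))) :
    (fl s r g).Nodup := by
  unfold fl
  refine List.Nodup.map_on ?_ (Finset.nodup_toList _)
  intro k hk k' hk' h
  rw [Finset.mem_toList, mem_Lset hs] at hk hk'
  have := congrArg Finset.card (enc_inj h)
  rwa [card_hh g hk.1.le, card_hh g hk'.1.le] at this

theorem mem_fl {s : ℕ → ℕ} {r : ℕ} {g : Equiv.Perm (Fin (s r))} {v : ℕ} :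
    v ∈ fl s r g ↔ ∃ k ∈ Lset s r, enc (hh g k) = v := by
  simp [fl]

theorem fl_toFinset_inj {s : ℕ → ℕ} (hs : StrictMono s) {r : ℕ}
    {g : Equiv.Perm (Fin (s r))} (hg : g ∈ GG s (s r))
    (h : (fl s r g).toFinset = (fl s r 1).toFinset) : g = 1 := by
  refine eq_one_of_hh hs hg fun k hk => ?_
  have h1 : enc (hh g k) ∈ (fl s r 1).toFinset := by
    rw [← h, List.mem_toFinset, mem_fl]
    exact ⟨k, hk, rfl⟩
  rw [List.mem_toFinset, mem_fl] at h1
  obtain ⟨k', hk', h2⟩ := h1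
  have h3 := enc_inj h2
  have h4 := congrArg Finset.card h3
  rw [card_hh _ ((mem_Lset hs).1 hk).1.le, card_hh _ ((mem_Lset hs).1 hk').1.le] at h4
  rw [← h3, h4]

theorem sign_ne (n : ℕ) (g : Equiv.Perm (Fin n)) :
    (((Equiv.Perm.sign g : ℤˣ) : ℤ) : K) ≠ 0 := by
  rcases Int.units_eq_one_or (Equiv.Perm.sign g) with h | h <;> simp [h]

theorem one_mem_GG (s : ℕ → ℕ) (n : ℕ) : (1 : Equiv.Perm (Fin n)) ∈ GG s n := by
  rw [mem_GG]; intro l x; rfl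

theorem ZZ_ne {s : ℕ → ℕ} (hs : StrictMono s) (r : ℕ) : ZZ K s r ≠ 0 := by
  intro h0
  have h1 : (bE K).repr (ZZ K s r) (fl s r 1).toFinset = 0 := by rw [h0]; simp
  unfold ZZ at h1
  rw [map_sum, Finsupp.finsetSum_apply, Finset.sum_eq_single 1] at h1
  · obtain ⟨u, hu, hw⟩ := repr_wl K (fl_nodup hs (1 : Equiv.Perm (Fin (s r))))
    rw [map_smul, hw] at h1
    rcases hu with rfl | rfl <;> simp at h1
  · intro g hg hne
    obtain ⟨u, hu, hw⟩ := repr_wl K (fl_nodup hs g)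
    rw [map_smul, hw, Finsupp.smul_apply, Finsupp.single_eq_of_ne, smul_zero]
    intro h
    exact hne (fl_toFinset_inj hs hg h.symm)
  · intro h; exact absurd (one_mem_GG _ _) h

theorem mem_sd {d : ℕ} {t : Finset ℕ} : t ∈ sd (simplexC d) ↔
    ∃ C : Finset (Finset ℕ), (∀ X ∈ C, X.Nonempty ∧ X ⊆ Finset.range d) ∧ IsChainF C ∧
      t = C.image enc := by
  unfold sd simplexC
  simp only [Finset.mem_image, Finset.mem_filter, Finset.mem_powerset]
  constructor
  · rintro ⟨C, ⟨h1, h2⟩, rfl⟩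
    refine ⟨C, fun X hX => ?_, h2, rfl⟩
    have := h1 hX
    rw [Finset.mem_erase, Finset.mem_powerset] at this
    exact ⟨Finset.nonempty_iff_ne_empty.2 this.1, this.2⟩
  · rintro ⟨C, h1, h2, rfl⟩
    refine ⟨C, ⟨fun X hX => ?_, h2⟩, rfl⟩
    rw [Finset.mem_erase, Finset.mem_powerset]
    exact ⟨Finset.nonempty_iff_ne_empty.1 (h1 X hX).1, (h1 X hX).2⟩

theorem redH_W {s : ℕ → ℕ} (hs : StrictMono s) (hs0 : s 0 = 0) {r d : ℕ} (hr : 2 ≤ r)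
    (hd : s r ≤ d) (W : Finset (Finset ℕ)) (hW0 : W0 s r ⊆ W) (hW : W ⊆ W0 s r ∪ Wn s r) :
    redHdim K (inducedSC (sd (simplexC d)) (W.image enc)) ((s r - r : ℕ) : ℤ) ≠ 0 := by
  refine redH_ne K _ _ (ZZ K s r) ?_ (DD_ZZ K hs hs0 r) (ZZ_ne K hs r)
    (fun v => enc (ret s r (dec v))) ?_ ?_
  · unfold ZZ
    rw [map_sum]
    refine Submodule.sum_mem _ fun g hg => ?_
    rw [map_smul]
    refine Submodule.smul_mem _ _ ?_
    obtain ⟨u, hu, hw⟩ := repr_wl K (fl_nodup hs g)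
    rw [hw, ← mul_one u, ← smul_eq_mul, ← Finsupp.smul_single]
    refine Submodule.smul_mem _ _ (Submodule.subset_span ⟨_, ⟨?_, ?_⟩, rfl⟩)
    · unfold inducedSC
      rw [Finset.mem_filter, mem_sd]
      refine ⟨⟨(Lset s r).image (hh g), ?_, ?_, ?_⟩, ?_⟩
      · intro X hX
        obtain ⟨k, hk, rfl⟩ := Finset.mem_image.1 hX
        have hm := hh_mem_W0 hs hs0 hg hk
        obtain ⟨x, hx, _⟩ := W0_meets hs hs0 hm
        exact ⟨⟨x, hx⟩, fun y hy => Finset.mem_range.2 ((W0_lt hs hm y hy).trans_le hd)⟩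
      · intro X hX Y hY
        obtain ⟨k, hk, rfl⟩ := Finset.mem_image.1 hX
        obtain ⟨k', hk', rfl⟩ := Finset.mem_image.1 hY
        rcases le_total k k' with h | h
        · exact Or.inl (hh_mono g h)
        · exact Or.inr (hh_mono g h)
      · ext v
        simp [mem_fl]
      · intro v hv
        rw [List.mem_toFinset, mem_fl] at hv
        obtain ⟨k, hk, rfl⟩ := hv
        exact Finset.mem_image_of_mem _ (hW0 (hh_mem_W0 hs hs0 hg hk))
    · rw [List.toFinset_card_of_nodup (fl_nodup hs g), fl, List.length_map, Finset.length_toList,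
        card_Lset hs]
  · unfold ZZ
    rw [map_sum]
    refine Finset.sum_congr rfl fun g hg => ?_
    rw [map_smul, fE_wl]
    congr 2
    conv_rhs => rw [← List.map_id (fl s r g)]
    refine List.map_congr_left fun v hv => ?_
    obtain ⟨k, hk, rfl⟩ := mem_fl.1 hv
    rw [dec_enc, ret_W0 hs hs0 (hh_mem_W0 hs hs0 hg hk), id]
  · intro t ht htc hinj
    unfold inducedSC at ht
    rw [Finset.mem_filter, mem_sd] at ht
    obtain ⟨⟨C, h1, h2, rfl⟩, h3⟩ := ht
    have hCW : ∀ X ∈ C, X ∈ W0 s r ∪ Wn s r := by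
      intro X hX
      obtain ⟨Y, hY, hYX⟩ := Finset.mem_image.1 (h3 (Finset.mem_image_of_mem enc hX))
      rw [← enc_inj hYX]
      exact hW hY
    rw [Finset.card_image_of_injective _ enc_inj] at htc
    have hinj2 : Set.InjOn (fun X => (ret s r X).card) (C : Set (Finset ℕ)) := by
      intro X hX Y hY h
      simp only at h
      have he : ret s r X = ret s r Y := by
        rcases h2 X hX Y hY with hs' | hs'
        · exact Finset.eq_of_subset_of_card_le
            (ret_mono hs hs0 hr (hCW X hX) (hCW Y hY) hs') h.ge
        · exact (Finset.eq_of_subset_of_card_le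
            (ret_mono hs hs0 hr (hCW Y hY) (hCW X hX) hs') h.le).symm
      apply enc_inj
      apply hinj
      · exact Finset.mem_coe.2 (Finset.mem_image_of_mem enc hX)
      · exact Finset.mem_coe.2 (Finset.mem_image_of_mem enc hY)
      · simp only [dec_enc, he]
    have := Finset.card_le_card_of_injOn (t := Lset s r) _
      (fun X hX => card_mem_Lset hs (ret_mem hs hs0 hr (hCW X hX))) hinj2
    rw [htc, card_Lset hs] at this
    omega

theorem betti_main {s : ℕ → ℕ} (hs : StrictMono s) (hs0 : s 0 = 0) {r d : ℕ} (hr : 2 ≤ r)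
    (hd : s r ≤ d) (i j : ℕ) (hj : j = s r - r) (h1 : (W0 s r).card ≤ i + j)
    (h2 : i + j ≤ (W0 s r).card + (Wn s r).card) :
    bettiSR K (sd (simplexC d)) i (i + j) ≠ 0 := by
  have hdisj : Disjoint (W0 s r) (Wn s r) := by
    rw [Finset.disjoint_left]
    intro X hX hX'
    obtain ⟨x, hx, hlt⟩ := W0_meets hs hs0 hX
    have := Wn_ge hs hr hX' x hx
    omega
  obtain ⟨W, hW0, hW, hc⟩ := Finset.exists_subsuperset_card_eq
    (Finset.subset_union_left : W0 s r ⊆ W0 s r ∪ Wn s r) h1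
    (by rw [Finset.card_union_of_disjoint hdisj]; exact h2)
  have hne := redH_W K hs hs0 hr hd W hW0 hW
  unfold bettiSR
  intro h0
  rw [Finset.sum_eq_zero_iff] at h0
  apply hne
  have := h0 (W.image enc) ?_
  · rw [← this, ← hj]
    congr 1
    push_cast
    ring
  · rw [Finset.mem_filter, Finset.mem_powerset, Finset.card_image_of_injective _ enc_inj]
    refine ⟨fun v hv => ?_, hc⟩
    obtain ⟨X, hX, rfl⟩ := Finset.mem_image.1 hv
    unfold vertexSet
    rw [Finset.mem_sup]
    refine ⟨{enc X}, ?_, by simp⟩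
    rw [mem_sd]
    refine ⟨{X}, ?_, ?_, by simp⟩
    · intro Y hY
      rw [Finset.mem_singleton.1 hY]
      rcases Finset.mem_union.1 (hW hX) with h | h
      · obtain ⟨x, hx, _⟩ := W0_meets hs hs0 h
        exact ⟨⟨x, hx⟩, fun y hy => Finset.mem_range.2 ((W0_lt hs h y hy).trans_le hd)⟩
      · refine ⟨?_, fun y hy => Finset.mem_range.2 ((Wn_ge hs hr h y hy).2.trans_le hd)⟩
        obtain ⟨M, A, _, h2, _, rfl⟩ := mem_Wn h
        exact h2.mono Finset.subset_union_right
    · intro Y hY Z hZ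
      rw [Finset.mem_singleton.1 hY, Finset.mem_singleton.1 hZ]
      exact Or.inl (Finset.Subset.refl _)

end CyclePart

/-- Nonvanishing of `β_{i,i+j}(K[sd(Δ_{d-1})])` on the range determined by
a tuple `(i_1,…,i_r)` with `i_1+⋯+i_r+(r-1) = j-1` and `i_1+⋯+i_r+2r ≤ d`. -/
theorem statement_7 (K : Type*) [Field K] (d r j : ℕ) (hd : 1 ≤ d) (hr : 2 ≤ r)
    (hj1 : 1 ≤ j) (hj2 : j ≤ d - 2) (iv : ℕ → ℕ)
    (h1 : (∑ l ∈ Finset.Icc 1 r, iv l) + (r - 1) = j - 1)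
    (h2 : (∑ l ∈ Finset.Icc 1 r, iv l) + 2 * r ≤ d)
    (i : ℕ)
    (hlo : (∑ l ∈ Finset.Icc 1 r, (2 ^ (iv l + 2) - 2)) - j ≤ i)
    (hhi : i ≤ (∑ l ∈ Finset.Icc 1 r, (2 ^ (iv l + 2) - 2)) +
      (2 ^ (iv r + 2) - 2) * 2 ^ ((∑ l ∈ Finset.Icc 2 (r - 1), iv l) + 2 * r - 4) - j) :
    bettiSR K (sd (simplexC d)) i (i + j) ≠ 0 := by
  have hicc : ∀ (F : ℕ → ℕ) (m : ℕ), ∑ l ∈ Finset.range m, F (l + 1) =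
      ∑ l ∈ Finset.Icc 1 m, F l := by
    intro F m
    rw [Finset.range_eq_Ico, Finset.sum_Ico_add' F 0 m 1]
    rfl
  let s : ℕ → ℕ := fun m => ∑ l ∈ Finset.range m, (iv (l + 1) + 2)
  have hsucc : ∀ m, s (m + 1) = s m + (iv (m + 1) + 2) := fun m => Finset.sum_range_succ _ _
  have hs : StrictMono s := strictMono_nat_of_lt_succ fun m => by rw [hsucc]; omega
  have hs0 : s 0 = 0 := rfl
  have hsm : ∀ m, s m = ∑ l ∈ Finset.Icc 1 m, iv l + 2 * m := by
    intro m
    rw [← hicc, mul_comm]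
    simp [s, Finset.sum_add_distrib]
  have hW0 : (W0 s r).card = ∑ l ∈ Finset.Icc 1 r, (2 ^ (iv l + 2) - 2) := by
    rw [card_W0 hs, ← hicc (fun l => 2 ^ (iv l + 2) - 2)]
    refine Finset.sum_congr rfl fun l _ => ?_
    rw [hsucc, Nat.add_sub_cancel_left]
  have hWn : (Wn s r).card = (2 ^ (iv r + 2) - 2) *
      2 ^ ((∑ l ∈ Finset.Icc 2 (r - 1), iv l) + 2 * r - 4) := by
    have e1 : s r - s (r - 1) = iv r + 2 := by
      have := hsucc (r - 1)
      rw [show r - 1 + 1 = r by omega] at this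
      omega
    have e2 : s (r - 1) - s 1 = (∑ l ∈ Finset.Icc 2 (r - 1), iv l) + 2 * r - 4 := by
      have h3 : ∑ l ∈ Finset.Icc 1 (r - 1), iv l = iv 1 + ∑ l ∈ Finset.Icc 2 (r - 1), iv l := by
        have := Finset.add_sum_Ioc_eq_sum_Icc (f := iv) (show 1 ≤ r - 1 by omega)
        rw [← this]
        rfl
      have h4 := hsm (r - 1)
      have h5 := hsucc 0
      rw [h3] at h4
      simp only [zero_add, hs0] at h5
      omega
    rw [card_Wn, e1, e2, mul_comm]
  have hsr := hsm r
  refine betti_main K hs hs0 hr (by omega) i j (by omega) (by omega) ?_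
  have hge : j ≤ ∑ l ∈ Finset.Icc 1 r, (2 ^ (iv l + 2) - 2) := by
    have h6 : ∑ l ∈ Finset.Icc 1 r, (iv l + 1) ≤ ∑ l ∈ Finset.Icc 1 r, (2 ^ (iv l + 2) - 2) := by
      refine Finset.sum_le_sum fun l _ => ?_
      have := Nat.lt_two_pow_self (n := iv l)
      rw [pow_add]
      omega
    have h7 : ∑ l ∈ Finset.Icc 1 r, (iv l + 1) = ∑ l ∈ Finset.Icc 1 r, iv l + r := by
      simp [Finset.sum_add_distrib]
    omega
  rw [hW0, hWn]
  omega
end
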